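/- arXiv:math/0702444 — 3 statements merged into one kernel-verified Lean document; each statement's English description precedes it below -/
import Mathlib

section
/- Let K be a field of characteristic zero, A and B graded Artinian K-algebras, V a finite graded A-module and W a finite graded B-module, and suppose the Hilbert functions of V and of W are both symmetric and unimodal. Then V ⊗_K W has the SLP as a graded A ⊗_K B-module if and only if both V has the SLP and W has the SLP. -/
set_option maxHeartbeats 1000000
set_option synthInstance.maxHeartbeats 400000

open TensorProduct

section LefschetzPrelude

variable (K : Type) [Field K]

/-- `𝒜` makes `A` into a graded Artinian `K`-algebra (with possibly non-standard
grading): `A` is the internal direct sum of the `𝒜 i`, the grading is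
multiplicative, `A₀ = K·1` and `A` is finite dimensional over `K`. -/
def IsGradedArtinAlg {A : Type} [CommRing A] [Algebra K A]
    (𝒜 : ℕ → Submodule K A) : Prop :=
  DirectSum.IsInternal 𝒜 ∧
  (1 : A) ∈ 𝒜 0 ∧
  (∀ i j : ℕ, ∀ x ∈ 𝒜 i, ∀ y ∈ 𝒜 j, x * y ∈ 𝒜 (i + j)) ∧
  𝒜 0 = Submodule.span K {(1 : A)} ∧
  FiniteDimensional K A

/-- `c` is the top degree of the grading `𝒜`. -/
def GradedTop {A : Type} [CommRing A] [Algebra K A]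
    (𝒜 : ℕ → Submodule K A) (c : ℕ) : Prop :=
  𝒜 c ≠ ⊥ ∧ ∀ i : ℕ, c < i → 𝒜 i = ⊥

/-- `ℳ` makes the `A`-module `V` into a finite graded module over the graded
algebra `(A, 𝒜)`. -/
def IsGradedMod {A V : Type} [CommRing A] [Algebra K A] [AddCommGroup V]
    [Module K V] [Module A V] [IsScalarTower K A V]
    (𝒜 : ℕ → Submodule K A) (ℳ : ℤ → Submodule K V) : Prop :=
  DirectSum.IsInternal ℳ ∧
  (∀ (i : ℕ) (j : ℤ), ∀ a ∈ 𝒜 i, ∀ v ∈ ℳ j, a • v ∈ ℳ (j + i)) ∧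
  FiniteDimensional K V

/-- The graded pieces of `ℳ` are supported exactly between degrees `a` and `b`. -/
def GradedBetween {V : Type} [AddCommGroup V] [Module K V]
    (ℳ : ℤ → Submodule K V) (a b : ℤ) : Prop :=
  a ≤ b ∧ ℳ a ≠ ⊥ ∧ ℳ b ≠ ⊥ ∧ ∀ i : ℤ, i < a ∨ b < i → ℳ i = ⊥

/-- Multiplication by `g : A` on the `A`-module `V`, as a `K`-linear endomorphism. -/
noncomputable def mulMap {A : Type} (V : Type) [CommRing A] [Algebra K A] [AddCommGroup V]
    [Module K V] [Module A V] [IsScalarTower K A V] (g : A) : Module.End K V :=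
  (LinearMap.lsmul A V g).restrictScalars K

/-- The endomorphism `f` of the graded vector space `ℳ` (supported between
degrees `a` and `b`) is a weak Lefschetz operator: each `f : ℳ i → ℳ (i+1)` is
injective or surjective. -/
def IsWLEndo {V : Type} [AddCommGroup V] [Module K V]
    (ℳ : ℤ → Submodule K V) (a b : ℤ) (f : Module.End K V) : Prop :=
  ∀ i : ℤ, a ≤ i → i + 1 ≤ b →
    ((∀ v ∈ ℳ i, f v = 0 → v = 0) ∨ (∀ w ∈ ℳ (i + 1), ∃ v ∈ ℳ i, f v = w))

/-- The endomorphism `f` of the graded vector space `ℳ` (supported between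
degrees `a` and `b`) is a strong Lefschetz operator:
`f^(b-a-2i) : ℳ (a+i) → ℳ (b-i)` is bijective for all `0 ≤ 2i ≤ b-a`. -/
def IsSLEndo {V : Type} [AddCommGroup V] [Module K V]
    (ℳ : ℤ → Submodule K V) (a b : ℤ) (f : Module.End K V) : Prop :=
  ∀ i : ℕ, 2 * (i : ℤ) ≤ b - a →
    (∀ v ∈ ℳ (a + i), (f ^ (b - a - 2 * i).toNat) v = 0 → v = 0) ∧
    (∀ w ∈ ℳ (b - i), ∃ v ∈ ℳ (a + i), (f ^ (b - a - 2 * i).toNat) v = w)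

/-- `g ∈ A₁` is a weak Lefschetz element for the graded module `(V, ℳ)`. -/
def IsWLElem {A V : Type} [CommRing A] [Algebra K A] [AddCommGroup V]
    [Module K V] [Module A V] [IsScalarTower K A V]
    (𝒜 : ℕ → Submodule K A) (ℳ : ℤ → Submodule K V) (a b : ℤ) (g : A) : Prop :=
  g ∈ 𝒜 1 ∧ IsWLEndo K ℳ a b (mulMap K V g)

/-- `g ∈ A₁` is a strong Lefschetz element for the graded module `(V, ℳ)`. -/
def IsSLElem {A V : Type} [CommRing A] [Algebra K A] [AddCommGroup V]
    [Module K V] [Module A V] [IsScalarTower K A V]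
    (𝒜 : ℕ → Submodule K A) (ℳ : ℤ → Submodule K V) (a b : ℤ) (g : A) : Prop :=
  g ∈ 𝒜 1 ∧ IsSLEndo K ℳ a b (mulMap K V g)

/-- The Hilbert function of the graded vector space `ℳ`. -/
noncomputable def hilb {V : Type} [AddCommGroup V] [Module K V]
    (ℳ : ℤ → Submodule K V) (i : ℤ) : ℕ :=
  Module.finrank K (ℳ i)

/-- The Hilbert function of `ℳ`, supported between `a` and `b`, is symmetric. -/
def SymHilb {V : Type} [AddCommGroup V] [Module K V]
    (ℳ : ℤ → Submodule K V) (a b : ℤ) : Prop :=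
  ∀ i : ℤ, hilb K ℳ (a + i) = hilb K ℳ (b - i)

/-- The Hilbert function of `ℳ`, supported between `a` and `b`, is unimodal. -/
def UnimodalHilb {V : Type} [AddCommGroup V] [Module K V]
    (ℳ : ℤ → Submodule K V) (a b : ℤ) : Prop :=
  ∃ m : ℤ, a ≤ m ∧ m ≤ b ∧
    (∀ i j : ℤ, a ≤ i → i ≤ j → j ≤ m → hilb K ℳ i ≤ hilb K ℳ j) ∧
    (∀ i j : ℤ, m ≤ i → i ≤ j → j ≤ b → hilb K ℳ j ≤ hilb K ℳ i)

/-- The Sperner number of `ℳ` (supported between `a` and `b`). -/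
noncomputable def sperner {V : Type} [AddCommGroup V] [Module K V]
    (ℳ : ℤ → Submodule K V) (a b : ℤ) : ℕ :=
  (Finset.Icc a b).sup fun i => hilb K ℳ i

/-- The CoSperner number of `ℳ` (supported between `a` and `b`). -/
noncomputable def coSperner {V : Type} [AddCommGroup V] [Module K V]
    (ℳ : ℤ → Submodule K V) (a b : ℤ) : ℕ :=
  ∑ i ∈ Finset.Icc a (b - 1), min (hilb K ℳ i) (hilb K ℳ (i + 1))

/-- `SP_k(V) = Σ_{i=a}^{b} max (dim V_i - dim V_{i-k}) 0` (via truncated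
subtraction on `ℕ`). -/
noncomputable def spernerVec {V : Type} [AddCommGroup V] [Module K V]
    (ℳ : ℤ → Submodule K V) (a b : ℤ) (k : ℕ) : ℕ :=
  ∑ i ∈ Finset.Icc a b, (hilb K ℳ i - hilb K ℳ (i - (k : ℤ)))

/-- `d` is the multiset of Jordan block sizes of the (nilpotent) endomorphism `f`:
all entries are positive and `dim ker f^k = Σ_{n ∈ d} min n k` for every `k`. -/
def IsJordanType {V : Type} [AddCommGroup V] [Module K V]
    (f : Module.End K V) (d : Multiset ℕ) : Prop :=
  (∀ n ∈ d, 0 < n) ∧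
  ∀ k : ℕ, Module.finrank K (LinearMap.ker (f ^ k)) = (d.map fun n => min n k).sum

/-- `g ∈ A₁` is a weak Lefschetz element of the graded algebra `(A, 𝒜)` with top
degree `c`. -/
def IsAlgWLElem {A : Type} [CommRing A] [Algebra K A]
    (𝒜 : ℕ → Submodule K A) (c : ℕ) (g : A) : Prop :=
  g ∈ 𝒜 1 ∧ ∀ i : ℕ, i + 1 ≤ c →
    ((∀ v ∈ 𝒜 i, g * v = 0 → v = 0) ∨ (∀ w ∈ 𝒜 (i + 1), ∃ v ∈ 𝒜 i, g * v = w))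

/-- `g ∈ A₁` is a strong Lefschetz element of the graded algebra `(A, 𝒜)` with top
degree `c`: `×g^(c-2i) : A_i → A_{c-i}` is bijective for `0 ≤ 2i ≤ c`. -/
def IsAlgSLElem {A : Type} [CommRing A] [Algebra K A]
    (𝒜 : ℕ → Submodule K A) (c : ℕ) (g : A) : Prop :=
  g ∈ 𝒜 1 ∧ ∀ i : ℕ, 2 * i ≤ c →
    (∀ v ∈ 𝒜 i, g ^ (c - 2 * i) * v = 0 → v = 0) ∧
    (∀ w ∈ 𝒜 (c - i), ∃ v ∈ 𝒜 i, g ^ (c - 2 * i) * v = w)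

/-- The graded algebra `(A, 𝒜)` has the weak Lefschetz property. -/
def AlgHasWLP {A : Type} [CommRing A] [Algebra K A] (𝒜 : ℕ → Submodule K A) : Prop :=
  ∃ c : ℕ, GradedTop K 𝒜 c ∧ ∃ g : A, IsAlgWLElem K 𝒜 c g

/-- The graded algebra `(A, 𝒜)` has the strong Lefschetz property. -/
def AlgHasSLP {A : Type} [CommRing A] [Algebra K A] (𝒜 : ℕ → Submodule K A) : Prop :=
  ∃ c : ℕ, GradedTop K 𝒜 c ∧ ∃ g : A, IsAlgSLElem K 𝒜 c g

/-- The graded pieces of the tensor product `V ⊗[K] W` of two graded vector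
spaces: `(ℳ ⊗ 𝒩)_k = Σ_{i+j=k} ℳ_i ⊗ 𝒩_j`. -/
noncomputable def tensorGrading {V W : Type} [AddCommGroup V] [Module K V]
    [AddCommGroup W] [Module K W] (ℳ : ℤ → Submodule K V) (𝒩 : ℤ → Submodule K W)
    (k : ℤ) : Submodule K (V ⊗[K] W) :=
  ⨆ i : ℤ, LinearMap.range (TensorProduct.map (ℳ i).subtype (𝒩 (k - i)).subtype)

/-- Reindex a `ℕ`-indexed grading by `ℤ`. -/
noncomputable def natToZ {V : Type} [AddCommGroup V] [Module K V]
    (ℒ : ℕ → Submodule K V) (i : ℤ) : Submodule K V :=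
  if 0 ≤ i then ℒ i.toNat else ⊥

/-- The truncated polynomial ring `K[t]/(t^α)`. -/
abbrev TruncPoly (α : ℕ) : Type :=
  Polynomial K ⧸ Ideal.span {(Polynomial.X : Polynomial K) ^ α}

/-- The image of `t` in `K[t]/(t^α)`. -/
noncomputable def tbar (α : ℕ) : TruncPoly K α :=
  Ideal.Quotient.mk _ Polynomial.X

/-- The standard grading of `K[t]/(t^α)` (with `deg t = 1`): the degree-`j` piece
is spanned by the class of `t^j` for `0 ≤ j < α`, and is zero otherwise. -/
noncomputable def truncGrading (α : ℕ) (j : ℤ) : Submodule K (TruncPoly K α) :=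
  if 0 ≤ j ∧ j < (α : ℤ) then Submodule.span K {tbar K α ^ j.toNat} else ⊥

end LefschetzPrelude

section LefschetzTensor

open Module

variable {K V W E : Type} [Field K] [AddCommGroup V] [Module K V] [AddCommGroup W] [Module K W]
  [AddCommGroup E] [Module K E]

theorem eq_zero_of_map_eq_zero_of_le_map [FiniteDimensional K E] {P Q : Submodule K E}
    {φ : End K E} (hdim : finrank K P ≤ finrank K Q) (hQ : Q ≤ P.map φ) :
    ∀ v ∈ P, φ v = 0 → v = 0 := by
  have hrk := LinearMap.finrank_range_add_finrank_ker (φ.domRestrict P)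
  have hrange : LinearMap.range (φ.domRestrict P) = P.map φ := by
    rw [LinearMap.domRestrict, LinearMap.range_comp, Submodule.range_subtype]
  rw [hrange] at hrk
  have hle := Submodule.finrank_mono hQ
  have hker : LinearMap.ker (φ.domRestrict P) = ⊥ := Submodule.finrank_eq_zero.mp (by omega)
  intro v hv h0
  have hmem : (⟨v, hv⟩ : P) ∈ LinearMap.ker (φ.domRestrict P) := by simpa using h0
  rw [hker, Submodule.mem_bot] at hmem
  simpa using hmem

theorem le_map_of_map_le_of_injOn [FiniteDimensional K E] {P Q : Submodule K E}
    {φ : End K E} (hdim : finrank K Q ≤ finrank K P) (hQ : P.map φ ≤ Q)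
    (hinj : ∀ v ∈ P, φ v = 0 → v = 0) : Q ≤ P.map φ := by
  have hrk := LinearMap.finrank_range_add_finrank_ker (φ.domRestrict P)
  have hrange : LinearMap.range (φ.domRestrict P) = P.map φ := by
    rw [LinearMap.domRestrict, LinearMap.range_comp, Submodule.range_subtype]
  have hker : LinearMap.ker (φ.domRestrict P) = ⊥ := by
    rw [LinearMap.ker_eq_bot']
    rintro ⟨v, hv⟩ h0
    exact Subtype.ext (hinj v hv h0)
  rw [hrange, hker, finrank_bot] at hrk
  exact (Submodule.eq_of_le_of_finrank_le hQ (by omega)).ge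

theorem pow_apply_mem {ℳ : ℤ → Submodule K V} {f : End K V}
    (hf : ∀ i, ∀ v ∈ ℳ i, f v ∈ ℳ (i + 1)) (n : ℕ) {i : ℤ} {v : V} (hv : v ∈ ℳ i) :
    (f ^ n) v ∈ ℳ (i + n) := by
  induction n with
  | zero => simpa using hv
  | succ n ih =>
    rw [pow_succ', Module.End.mul_apply]
    have := hf _ _ ih
    rwa [add_assoc] at this

theorem tensorGrading_eq_iSup_map₂ (ℳ : ℤ → Submodule K V) (𝒩 : ℤ → Submodule K W) (k : ℤ) :
    tensorGrading K ℳ 𝒩 k = ⨆ i, Submodule.map₂ (TensorProduct.mk K V W) (ℳ i) (𝒩 (k - i)) := by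
  simp only [tensorGrading, TensorProduct.range_map, Submodule.range_subtype]

theorem tmul_mem_tensorGrading {ℳ : ℤ → Submodule K V} {𝒩 : ℤ → Submodule K W} {i j k : ℤ}
    (hk : i + j = k) {v : V} {w : W} (hv : v ∈ ℳ i) (hw : w ∈ 𝒩 j) :
    v ⊗ₜ[K] w ∈ tensorGrading K ℳ 𝒩 k := by
  obtain rfl : j = k - i := by omega
  rw [tensorGrading_eq_iSup_map₂]
  exact Submodule.mem_iSup_of_mem i (Submodule.apply_mem_map₂ _ hv hw)

/-- A polynomial vanishing at `0` and `1` to orders adding up to more than its degree is zero. -/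
theorem Polynomial.eq_zero_of_coeff_of_hasseDeriv {G : Polynomial K} {m s t : ℕ}
    (hdeg : G.degree < m) (hm : m ≤ s + (t + 1)) (h0 : ∀ j < s, G.coeff j = 0)
    (h1 : ∀ i ≤ t, (Polynomial.hasseDeriv i G).eval 1 = 0) : G = 0 := by
  have hX : (Polynomial.X : Polynomial K) ^ s ∣ G := Polynomial.X_pow_dvd_iff.mpr h0
  have hX1 : (Polynomial.X - Polynomial.C 1 : Polynomial K) ^ (t + 1) ∣ G := by
    rw [Polynomial.X_sub_C_pow_dvd_iff, ← Polynomial.taylor_apply, Polynomial.X_pow_dvd_iff]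
    intro i hi
    rw [Polynomial.taylor_coeff]
    exact h1 i (by omega)
  have hcop : IsCoprime ((Polynomial.X : Polynomial K) ^ s)
      ((Polynomial.X - Polynomial.C 1 : Polynomial K) ^ (t + 1)) := by
    apply IsCoprime.pow
    exact ⟨1, -1, by simp⟩
  refine Polynomial.eq_zero_of_dvd_of_degree_lt (hcop.mul_dvd hX hX1) (hdeg.trans_le ?_)
  rw [Polynomial.degree_mul, Polynomial.degree_X_pow, Polynomial.degree_pow,
    Polynomial.degree_X_sub_C]
  simp only [nsmul_eq_mul, mul_one]
  exact_mod_cast hm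

/-- In characteristic zero, the monomials of degree `d` in two commuting operators `X`, `Y`
with `X ^ m u = 0` and `Y ^ n u = 0` are reached by the elements `(X + Y) ^ (d - i) X ^ i u`. -/
theorem pow_mul_pow_apply_mem [CharZero K] {X Y : End K E} (hXY : Commute X Y) {u : E}
    {m n d t : ℕ} (hXu : (X ^ m) u = 0) (hYu : (Y ^ n) u = 0) (htd : t ≤ d)
    (hd : d + t + 2 = m + n) (S : Submodule K E)
    (hS : ∀ i ≤ t, ((X + Y) ^ (d - i) * X ^ i) u ∈ S) {j : ℕ} (hj : j ≤ d) :
    (X ^ j * Y ^ (d - j)) u ∈ S := by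
  by_contra hnot
  obtain ⟨φ, hφ, hSφ⟩ := Submodule.exists_le_ker_of_notMem hnot
  set c : ℕ → K := fun j => φ ((X ^ j * Y ^ (d - j)) u) with hc
  have hcm : ∀ j, m ≤ j → c j = 0 := by
    intro j hmj
    have : (X ^ j * Y ^ (d - j)) u = 0 := by
      rw [(hXY.pow_pow j (d - j)).eq, ← Nat.sub_add_cancel hmj, pow_add, ← mul_assoc,
        Module.End.mul_apply, hXu, map_zero]
    simp only [hc, this, map_zero]
  have hcn : ∀ j, n ≤ d - j → c j = 0 := by
    intro j hnj
    have : (X ^ j * Y ^ (d - j)) u = 0 := by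
      rw [← Nat.sub_add_cancel hnj, pow_add, ← mul_assoc, Module.End.mul_apply, hYu, map_zero]
    simp only [hc, this, map_zero]
  set G : Polynomial K :=
    ∑ j ∈ Finset.range (d + 1), Polynomial.monomial j ((d.choose j : K) * c j) with hG
  have hcoeff : ∀ j, G.coeff j = (d.choose j : K) * c j := by
    intro j
    rw [hG, Polynomial.finsetSum_coeff]
    simp only [Polynomial.coeff_monomial, Finset.sum_ite_eq', Finset.mem_range]
    split_ifs with h
    · rfl
    · rw [Nat.choose_eq_zero_of_lt (by omega)]; simp
  have hG0 : G = 0 := by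
    refine Polynomial.eq_zero_of_coeff_of_hasseDeriv (m := m) (s := m - 1 - t) (t := t)
      ?_ (by omega) ?_ ?_
    · rw [Polynomial.degree_lt_iff_coeff_zero]
      intro j hmj
      rw [hcoeff, hcm j hmj, mul_zero]
    · intro j hjs
      rw [hcoeff, hcn j (by omega), mul_zero]
    · intro i hi
      have hφi : φ (((X + Y) ^ (d - i) * X ^ i) u) = 0 := hSφ (hS i hi)
      rw [hXY.add_pow, Finset.sum_mul, LinearMap.sum_apply, map_sum] at hφi
      have hterm : ∀ l ∈ Finset.range (d - i + 1),
          φ ((X ^ l * Y ^ (d - i - l) * ((d - i).choose l : End K E) * X ^ i) u) =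
            ((d - i).choose l : K) * c (i + l) := by
        intro l hl
        have : X ^ l * Y ^ (d - i - l) * ((d - i).choose l : End K E) * X ^ i =
            ((d - i).choose l : K) • (X ^ (i + l) * Y ^ (d - (i + l))) := by
          rw [mul_assoc, (Nat.cast_commute _ _).eq, ← mul_assoc, mul_assoc (X ^ l),
            ← (hXY.pow_pow i (d - i - l)).eq, ← mul_assoc, ← pow_add, add_comm l i,
            Nat.sub_sub, ← (Nat.cast_commute _ _).eq, ← nsmul_eq_mul, Nat.cast_smul_eq_nsmul]
        rw [this, LinearMap.smul_apply, map_smul, smul_eq_mul]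
      rw [Finset.sum_congr rfl hterm] at hφi
      have hexp : (Polynomial.hasseDeriv i G).eval 1 =
          ∑ j ∈ Finset.range (d + 1), (j.choose i : K) * ((d.choose j : K) * c j) := by
        rw [hG, map_sum, Polynomial.eval_finsetSum]
        simp [Polynomial.hasseDeriv_monomial]
      have hdi : d + 1 = i + (d - i + 1) := by omega
      rw [hexp, hdi, Finset.sum_range_add, Finset.sum_eq_zero, zero_add]
      · rw [← mul_zero (d.choose i : K), ← hφi, Finset.mul_sum]
        refine Finset.sum_congr rfl fun l hl => ?_
        have := Nat.choose_mul (n := d) (k := i + l) (s := i) (by omega)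
        rw [Nat.add_sub_cancel_left] at this
        have hK : (d.choose (i + l) : K) * ((i + l).choose i : K) =
            (d.choose i : K) * ((d - i).choose l : K) := by exact_mod_cast this
        linear_combination c (i + l) * hK
      · intro j hj
        rw [Nat.choose_eq_zero_of_lt (Finset.mem_range.mp hj)]
        simp
  have hcj := hcoeff j
  rw [hG0, Polynomial.coeff_zero, eq_comm, mul_eq_zero] at hcj
  rcases hcj with h | h
  · exact (Nat.choose_pos hj).ne' (by exact_mod_cast h)
  · exact hφ h

/-- The vectors of degree `e` lying on a Jordan string centred at `(a + b) / 2`. -/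
def centredStrings (ℳ : ℤ → Submodule K V) (a b : ℤ) (f : End K V) (e : ℤ) : Set V :=
  {v | ∃ (i j : ℕ), ∃ p ∈ ℳ (a + i), 2 * (i : ℤ) ≤ b - a ∧ a + i + j = e ∧
    (f ^ ((b - a - 2 * i).toNat + 1)) p = 0 ∧ v = (f ^ j) p}

theorem pow_apply_mem_span_centredStrings {ℳ : ℤ → Submodule K V} {a b : ℤ} {f : End K V}
    (n : ℕ) {e e' : ℤ} (he : e + n = e') {v : V}
    (hv : v ∈ Submodule.span K (centredStrings ℳ a b f e)) :
    (f ^ n) v ∈ Submodule.span K (centredStrings ℳ a b f e') := by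
  have hle : Submodule.span K (centredStrings ℳ a b f e) ≤
      (Submodule.span K (centredStrings ℳ a b f e')).comap (f ^ n) := by
    rw [Submodule.span_le]
    rintro _ ⟨i, j, p, hp, hi, hij, hprim, rfl⟩
    refine Submodule.subset_span ⟨i, n + j, p, hp, hi, by push_cast; omega, hprim, ?_⟩
    rw [pow_add, Module.End.mul_apply]
  exact hle hv

theorem IsSLEndo.le_span_centredStrings {ℳ : ℤ → Submodule K V} {a b : ℤ} {f : End K V}
    (hf : ∀ i, ∀ v ∈ ℳ i, f v ∈ ℳ (i + 1)) (hbd : GradedBetween K ℳ a b)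
    (hSL : IsSLEndo K ℳ a b f) (e : ℤ) :
    ℳ e ≤ Submodule.span K (centredStrings ℳ a b f e) := by
  have hlow : ∀ i : ℕ, 2 * (i : ℤ) ≤ b - a →
      ℳ (a + i) ≤ Submodule.span K (centredStrings ℳ a b f (a + i)) := by
    intro i
    induction i with
    | zero =>
      intro hi v hv
      refine Submodule.subset_span ⟨0, 0, v, hv, hi, by simp, ?_, by simp⟩
      have hmem := pow_apply_mem hf ((b - a - 2 * (0 : ℕ)).toNat + 1) hv
      rwa [hbd.2.2.2 _ (by push_cast at hi ⊢; omega), Submodule.mem_bot] at hmem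
    | succ i ih =>
      intro hi v hv
      push_cast at hi
      have hmem := pow_apply_mem hf ((b - a - 2 * (i + 1 : ℕ)).toNat + 1) hv
      have hdeg : a + ((i + 1 : ℕ) : ℤ) + ((b - a - 2 * (i + 1 : ℕ)).toNat + 1 : ℕ) = b - i := by
        push_cast; omega
      rw [hdeg] at hmem
      obtain ⟨u, hu, huv⟩ := (hSL i (by omega)).2 _ hmem
      have hexp : (b - a - 2 * (i : ℤ)).toNat = (b - a - 2 * (i + 1 : ℕ)).toNat + 1 + 1 := by
        push_cast; omega
      have hfu : f u ∈ ℳ (a + (i + 1 : ℕ)) := by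
        have := hf _ _ hu
        rwa [show a + (i : ℤ) + 1 = a + (i + 1 : ℕ) by push_cast; ring] at this
      have hspan : f u ∈ Submodule.span K (centredStrings ℳ a b f (a + (i + 1 : ℕ))) := by
        simpa using pow_apply_mem_span_centredStrings (e' := a + (i + 1 : ℕ)) 1
          (by push_cast; ring) (ih (by omega) hu)
      rw [← sub_add_cancel v (f u)]
      refine add_mem (Submodule.subset_span
        ⟨i + 1, 0, v - f u, sub_mem hv hfu, by push_cast; omega, by simp, ?_, by simp⟩) hspan
      rw [map_sub, ← huv, hexp, pow_succ _ (_ + 1), Module.End.mul_apply, sub_self]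
  intro v hv
  by_cases hout : e < a ∨ b < e
  · rw [hbd.2.2.2 e hout, Submodule.mem_bot] at hv
    rw [hv]
    exact zero_mem _
  · push Not at hout
    by_cases hmid : 2 * (e - a) ≤ b - a
    · have := hlow (e - a).toNat (by omega)
      rw [show a + ((e - a).toNat : ℤ) = e by omega] at this
      exact this hv
    · have hi : 2 * ((b - e).toNat : ℤ) ≤ b - a := by omega
      obtain ⟨u, hu, rfl⟩ := (hSL (b - e).toNat hi).2 v
        (by rwa [show b - ((b - e).toNat : ℤ) = e by omega])
      exact pow_apply_mem_span_centredStrings _ (by omega) (hlow _ hi hu)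

theorem exists_map_eq_reflection {ℳ : ℤ → Submodule K V} {a b : ℤ} [FiniteDimensional K V]
    (hint : DirectSum.IsInternal ℳ) (hsym : SymHilb K ℳ a b) :
    ∃ σ : End K V, ∀ i, (ℳ i).map σ = ℳ (a + b - i) := by
  have hdim : ∀ i, finrank K (ℳ i) = finrank K (ℳ (a + b - i)) := by
    intro i
    have := hsym (i - a)
    rwa [hilb, hilb, show a + (i - a) = i by ring, show b - (i - a) = a + b - i by ring] at this
  let e : ∀ i, ℳ i ≃ₗ[K] ℳ (a + b - i) := fun i => LinearEquiv.ofFinrankEq _ _ (hdim i)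
  let D := LinearEquiv.ofBijective (DirectSum.coeLinearMap ℳ) hint
  let τ : DirectSum ℤ (fun i => ℳ i) →ₗ[K] V :=
    DirectSum.toModule K ℤ V fun i => (ℳ (a + b - i)).subtype ∘ₗ (e i).toLinearMap
  have hσ : ∀ i (x : ℳ i), (τ ∘ₗ D.symm.toLinearMap) (x : V) = (e i x : V) := by
    intro i x
    have hx : D.symm (x : V) = DirectSum.lof K ℤ (fun i => ℳ i) i x := by
      rw [LinearEquiv.symm_apply_eq]
      exact (DirectSum.coeLinearMap_lof ℳ i x).symm
    rw [LinearMap.comp_apply, LinearEquiv.coe_coe, hx, DirectSum.toModule_lof]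
    rfl
  refine ⟨τ ∘ₗ D.symm.toLinearMap, fun i => le_antisymm ?_ ?_⟩
  · rintro _ ⟨x, hx, rfl⟩
    rw [hσ i ⟨x, hx⟩]
    exact (e i ⟨x, hx⟩).2
  · intro y hy
    refine ⟨(e i).symm ⟨y, hy⟩, ((e i).symm ⟨y, hy⟩).2, ?_⟩
    rw [hσ i, LinearEquiv.apply_symm_apply]

theorem finrank_tensorGrading_reflection_le {ℳ : ℤ → Submodule K V} {𝒩 : ℤ → Submodule K W}
    {a b a' b' : ℤ} [FiniteDimensional K V] [FiniteDimensional K W]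
    (hM : DirectSum.IsInternal ℳ) (hN : DirectSum.IsInternal 𝒩)
    (hsymV : SymHilb K ℳ a b) (hsymW : SymHilb K 𝒩 a' b') {k l : ℤ}
    (hkl : k + l = a + b + a' + b') :
    finrank K (tensorGrading K ℳ 𝒩 l) ≤ finrank K (tensorGrading K ℳ 𝒩 k) := by
  obtain ⟨σ, hσ⟩ := exists_map_eq_reflection hM hsymV
  obtain ⟨τ, hτ⟩ := exists_map_eq_reflection hN hsymW
  refine le_trans (Submodule.finrank_mono ?_)
    (Submodule.finrank_map_le (TensorProduct.map σ τ) (tensorGrading K ℳ 𝒩 k))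
  rw [tensorGrading_eq_iSup_map₂ ℳ 𝒩 l]
  refine iSup_le fun i => Submodule.map₂_le.mpr fun v hv w hw => ?_
  rw [show i = a + b - (a + b - i) by ring, ← hσ] at hv
  rw [show l - i = a' + b' - (a' + b' - (l - i)) by ring, ← hτ] at hw
  obtain ⟨v, hv, rfl⟩ := hv
  obtain ⟨w, hw, rfl⟩ := hw
  exact ⟨v ⊗ₜ w, tmul_mem_tensorGrading (by omega) hv hw, by simp⟩

/-- The Leibniz extension `f ⊗ 1 + 1 ⊗ h` to the tensor product. -/
noncomputable abbrev tensorSum (f : End K V) (h : End K W) : End K (V ⊗[K] W) :=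
  TensorProduct.map f LinearMap.id + TensorProduct.map LinearMap.id h

theorem commute_map_id (f : End K V) (h : End K W) :
    Commute (TensorProduct.map f LinearMap.id : End K (V ⊗[K] W))
      (TensorProduct.map LinearMap.id h) := by
  ext
  simp

theorem map_id_pow_tmul (f : End K V) (n : ℕ) (v : V) (w : W) :
    ((TensorProduct.map f LinearMap.id : End K (V ⊗[K] W)) ^ n) (v ⊗ₜ w) = (f ^ n) v ⊗ₜ w := by
  rw [TensorProduct.map_pow]
  simp [← Module.End.one_eq_id]

theorem id_map_pow_tmul (h : End K W) (n : ℕ) (v : V) (w : W) :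
    ((TensorProduct.map LinearMap.id h : End K (V ⊗[K] W)) ^ n) (v ⊗ₜ w) = v ⊗ₜ (h ^ n) w := by
  rw [TensorProduct.map_pow]
  simp [← Module.End.one_eq_id]

theorem tensorSum_apply_mem {ℳ : ℤ → Submodule K V} {𝒩 : ℤ → Submodule K W} {f : End K V}
    {h : End K W} (hf : ∀ i, ∀ v ∈ ℳ i, f v ∈ ℳ (i + 1))
    (hh : ∀ i, ∀ w ∈ 𝒩 i, h w ∈ 𝒩 (i + 1)) (k : ℤ) :
    ∀ x ∈ tensorGrading K ℳ 𝒩 k, tensorSum f h x ∈ tensorGrading K ℳ 𝒩 (k + 1) := by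
  suffices hle : tensorGrading K ℳ 𝒩 k ≤
      (tensorGrading K ℳ 𝒩 (k + 1)).comap (tensorSum f h) from hle
  rw [tensorGrading_eq_iSup_map₂ ℳ 𝒩 k]
  refine iSup_le fun i => Submodule.map₂_le.mpr fun v hv w hw => ?_
  exact add_mem (tmul_mem_tensorGrading (by ring) (hf _ _ hv) hw)
    (tmul_mem_tensorGrading (by ring) hv (hh _ _ hw))

theorem isSLEndo_tensorSum [CharZero K] {ℳ : ℤ → Submodule K V} {𝒩 : ℤ → Submodule K W}
    {a b a' b' : ℤ} [FiniteDimensional K V] [FiniteDimensional K W] {f : End K V} {h : End K W}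
    (hM : DirectSum.IsInternal ℳ) (hN : DirectSum.IsInternal 𝒩)
    (hsymV : SymHilb K ℳ a b) (hsymW : SymHilb K 𝒩 a' b')
    (hbdV : GradedBetween K ℳ a b) (hbdW : GradedBetween K 𝒩 a' b')
    (hf : ∀ i, ∀ v ∈ ℳ i, f v ∈ ℳ (i + 1)) (hh : ∀ i, ∀ w ∈ 𝒩 i, h w ∈ 𝒩 (i + 1))
    (hfSL : IsSLEndo K ℳ a b f) (hhSL : IsSLEndo K 𝒩 a' b' h) :
    IsSLEndo K (tensorGrading K ℳ 𝒩) (a + a') (b + b') (tensorSum f h) := by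
  intro k hk
  set N := (b + b' - (a + a') - 2 * (k : ℤ)).toNat with hN_def
  have hsurj : tensorGrading K ℳ 𝒩 (b + b' - k) ≤
      (tensorGrading K ℳ 𝒩 (a + a' + k)).map (tensorSum f h ^ N) := by
    rw [tensorGrading_eq_iSup_map₂ ℳ 𝒩 (b + b' - k)]
    refine iSup_le fun e => ?_
    refine (Submodule.map₂_le_map₂ (hfSL.le_span_centredStrings hf hbdV e)
      (hhSL.le_span_centredStrings hh hbdW _)).trans ?_
    rw [Submodule.map₂_span_span, Submodule.span_le]
    rintro _ ⟨_, ⟨i, j, p, hp, hi, hij, hprim, rfl⟩, _,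
      ⟨i', j', q, hq, hi', hij', hprim', rfl⟩, rfl⟩
    set m := (b - a - 2 * (i : ℤ)).toNat + 1 with hm
    set n := (b' - a' - 2 * (i' : ℤ)).toNat + 1 with hn
    change (f ^ j) p ⊗ₜ[K] (h ^ j') q ∈ _
    by_cases hki : i + i' ≤ k
    · have key := pow_mul_pow_apply_mem (commute_map_id f h) (u := p ⊗ₜ[K] q) (m := m) (n := n)
        (d := j + j') (t := k - i - i')
        (by rw [map_id_pow_tmul, hprim, TensorProduct.zero_tmul])
        (by rw [id_map_pow_tmul, hprim', TensorProduct.tmul_zero]) (by omega) (by omega)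
        ((tensorGrading K ℳ 𝒩 (a + a' + k)).map (tensorSum f h ^ N)) ?_
        (Nat.le_add_right j j')
      · rwa [Nat.add_sub_cancel_left, Module.End.mul_apply, id_map_pow_tmul,
          map_id_pow_tmul] at key
      · intro r hr
        rw [show j + j' - r = N + (k - i - i' - r) by omega, pow_add, mul_assoc,
          Module.End.mul_apply]
        refine Submodule.mem_map_of_mem ?_
        rw [Module.End.mul_apply, map_id_pow_tmul]
        have := pow_apply_mem (tensorSum_apply_mem hf hh) (k - i - i' - r)
          (tmul_mem_tensorGrading rfl (pow_apply_mem hf r hp) hq)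
        convert this using 2
        omega
    · rcases Nat.lt_or_ge j m with hjm | hjm
      · obtain ⟨r, hr⟩ := Nat.exists_eq_add_of_le' (show n ≤ j' by omega)
        rw [hr, pow_add, Module.End.mul_apply, hprim', map_zero, TensorProduct.tmul_zero]
        exact zero_mem _
      · obtain ⟨r, hr⟩ := Nat.exists_eq_add_of_le' hjm
        rw [hr, pow_add, Module.End.mul_apply, hprim, map_zero, TensorProduct.zero_tmul]
        exact zero_mem _
  refine ⟨eq_zero_of_map_eq_zero_of_le_map ?_ hsurj, fun w hw => hsurj hw⟩
  exact finrank_tensorGrading_reflection_le hM hN hsymV hsymW (by ring)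

theorem tensorSum_pow_tmul_eq_zero {f : End K V} {h : End K W} {v : V} {w : W} {m n N : ℕ}
    (hv : (f ^ m) v = 0) (hw : (h ^ n) w = 0) (hN : m + n ≤ N + 1) :
    (tensorSum f h ^ N) (v ⊗ₜ w) = 0 := by
  rw [(commute_map_id f h).add_pow, LinearMap.sum_apply]
  refine Finset.sum_eq_zero fun r hr => ?_
  rw [← (Nat.cast_commute _ _).eq, ← nsmul_eq_mul, LinearMap.smul_apply, Module.End.mul_apply,
    id_map_pow_tmul, map_id_pow_tmul]
  rcases Nat.lt_or_ge r m with hlt | hge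
  · rw [← Nat.sub_add_cancel (show n ≤ N - r by omega), pow_add, Module.End.mul_apply, hw, map_zero,
      TensorProduct.tmul_zero, smul_zero]
  · rw [← Nat.sub_add_cancel hge, pow_add, Module.End.mul_apply, hv, map_zero,
      TensorProduct.zero_tmul, smul_zero]

theorem GradedBetween.pow_apply_eq_zero {ℳ : ℤ → Submodule K V} {a b : ℤ} {f : End K V}
    (hbd : GradedBetween K ℳ a b) (hf : ∀ i, ∀ v ∈ ℳ i, f v ∈ ℳ (i + 1)) {v : V}
    (hv : v ∈ ℳ a) : (f ^ ((b - a).toNat + 1)) v = 0 := by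
  have hmem := pow_apply_mem hf ((b - a).toNat + 1) hv
  rwa [hbd.2.2.2 _ (by omega), Submodule.mem_bot] at hmem

theorem eq_zero_or_eq_zero_of_tmul_eq_zero {v : V} {w : W} (hvw : v ⊗ₜ[K] w = 0) :
    v = 0 ∨ w = 0 := by
  by_contra! hne
  obtain ⟨φ, hφ⟩ := not_forall.mp (mt (Module.forall_dual_apply_eq_zero_iff K v).mp hne.1)
  obtain ⟨ψ, hψ⟩ := not_forall.mp (mt (Module.forall_dual_apply_eq_zero_iff K w).mp hne.2)
  have hmul := congrArg (LinearMap.mul' K K ∘ₗ TensorProduct.map φ ψ) hvw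
  simp [hφ, hψ] at hmul

theorem IsSLEndo.injOn_left_of_tensorSum {ℳ : ℤ → Submodule K V} {𝒩 : ℤ → Submodule K W}
    {a b a' b' : ℤ} {f : End K V} {h : End K W} (hbdW : GradedBetween K 𝒩 a' b')
    (hh : ∀ i, ∀ w ∈ 𝒩 i, h w ∈ 𝒩 (i + 1))
    (hSL : IsSLEndo K (tensorGrading K ℳ 𝒩) (a + a') (b + b') (tensorSum f h))
    {i : ℕ} (hi : 2 * (i : ℤ) ≤ b - a) :
    ∀ v ∈ ℳ (a + i), (f ^ (b - a - 2 * i).toNat) v = 0 → v = 0 := by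
  intro v hv hv0
  have hab' := hbdW.1
  obtain ⟨w, hw, hw0⟩ := Submodule.exists_mem_ne_zero_of_ne_bot hbdW.2.1
  have hzero : v ⊗ₜ[K] w = 0 :=
    (hSL i (by omega)).1 _ (tmul_mem_tensorGrading (by ring) hv hw)
      (tensorSum_pow_tmul_eq_zero hv0 (hbdW.pow_apply_eq_zero hh hw) (by omega))
  exact (eq_zero_or_eq_zero_of_tmul_eq_zero hzero).resolve_right hw0

theorem IsSLEndo.injOn_right_of_tensorSum {ℳ : ℤ → Submodule K V} {𝒩 : ℤ → Submodule K W}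
    {a b a' b' : ℤ} {f : End K V} {h : End K W} (hbdV : GradedBetween K ℳ a b)
    (hf : ∀ i, ∀ v ∈ ℳ i, f v ∈ ℳ (i + 1))
    (hSL : IsSLEndo K (tensorGrading K ℳ 𝒩) (a + a') (b + b') (tensorSum f h))
    {i : ℕ} (hi : 2 * (i : ℤ) ≤ b' - a') :
    ∀ w ∈ 𝒩 (a' + i), (h ^ (b' - a' - 2 * i).toNat) w = 0 → w = 0 := by
  intro w hw hw0
  have hab := hbdV.1
  obtain ⟨v, hv, hv0⟩ := Submodule.exists_mem_ne_zero_of_ne_bot hbdV.2.1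
  have hzero : v ⊗ₜ[K] w = 0 :=
    (hSL i (by omega)).1 _ (tmul_mem_tensorGrading (by ring) hv hw)
      (tensorSum_pow_tmul_eq_zero (hbdV.pow_apply_eq_zero hf hv) hw0 (by omega))
  exact (eq_zero_or_eq_zero_of_tmul_eq_zero hzero).resolve_left hv0

theorem isSLEndo_of_injOn [FiniteDimensional K V] {ℳ : ℤ → Submodule K V} {a b : ℤ}
    {f : End K V} (hsym : SymHilb K ℳ a b) (hf : ∀ i, ∀ v ∈ ℳ i, f v ∈ ℳ (i + 1))
    (hinj : ∀ i : ℕ, 2 * (i : ℤ) ≤ b - a →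
      ∀ v ∈ ℳ (a + i), (f ^ (b - a - 2 * i).toNat) v = 0 → v = 0) :
    IsSLEndo K ℳ a b f := by
  refine fun i hi => ⟨hinj i hi, fun w hw => ?_⟩
  refine le_map_of_map_le_of_injOn (hsym i).ge ?_ (hinj i hi) hw
  rintro _ ⟨v, hv, rfl⟩
  convert pow_apply_mem hf (b - a - 2 * (i : ℤ)).toNat hv using 2
  omega

theorem IsGradedMod.mulMap_apply_mem {A : Type} [CommRing A] [Algebra K A] [Module A V]
    [IsScalarTower K A V] {𝒜 : ℕ → Submodule K A} {ℳ : ℤ → Submodule K V}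
    (hM : IsGradedMod K 𝒜 ℳ) {g : A} (hg : g ∈ 𝒜 1) :
    ∀ i, ∀ v ∈ ℳ i, mulMap K V g v ∈ ℳ (i + 1) :=
  fun i v hv => hM.2.1 1 i g hg v hv

end LefschetzTensor

/-- Theorem 3.10. Let `V` be a finite graded `A`-module and
`W` a finite graded `B`-module, both with symmetric unimodal Hilbert functions.
Then `V ⊗_K W` has the SLP as a graded `A ⊗_K B`-module (a linear form of
`A ⊗_K B` is precisely an element `g ⊗ 1 + 1 ⊗ h` with `g ∈ A₁`, `h ∈ B₁`)
if and only if both `V` and `W` have the SLP. -/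
theorem statement_5 {K A B V W : Type} [Field K] [CharZero K]
    [CommRing A] [Algebra K A] [CommRing B] [Algebra K B]
    [AddCommGroup V] [Module K V] [Module A V] [IsScalarTower K A V]
    [AddCommGroup W] [Module K W] [Module B W] [IsScalarTower K B W]
    (𝒜 : ℕ → Submodule K A) (ℬ : ℕ → Submodule K B)
    (ℳ : ℤ → Submodule K V) (𝒩 : ℤ → Submodule K W) (a b a' b' : ℤ)
    (hA : IsGradedArtinAlg K 𝒜) (hB : IsGradedArtinAlg K ℬ)
    (hM : IsGradedMod K 𝒜 ℳ) (hN : IsGradedMod K ℬ 𝒩)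
    (hbdV : GradedBetween K ℳ a b) (hbdW : GradedBetween K 𝒩 a' b')
    (hsymV : SymHilb K ℳ a b) (huniV : UnimodalHilb K ℳ a b)
    (hsymW : SymHilb K 𝒩 a' b') (huniW : UnimodalHilb K 𝒩 a' b') :
    (∃ g ∈ 𝒜 1, ∃ h ∈ ℬ 1,
      IsSLEndo K (tensorGrading K ℳ 𝒩) (a + a') (b + b')
        (TensorProduct.map (mulMap K V g) LinearMap.id +
          TensorProduct.map LinearMap.id (mulMap K W h))) ↔
    ((∃ g : A, IsSLElem K 𝒜 ℳ a b g) ∧ (∃ h : B, IsSLElem K ℬ 𝒩 a' b' h)) := by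
  have hfinV : FiniteDimensional K V := hM.2.2
  have hfinW : FiniteDimensional K W := hN.2.2
  constructor
  · rintro ⟨g, hg, h, hh, hSL⟩
    have hgd := hM.mulMap_apply_mem hg
    have hhd := hN.mulMap_apply_mem hh
    exact ⟨⟨g, hg, isSLEndo_of_injOn hsymV hgd fun i hi => hSL.injOn_left_of_tensorSum hbdW hhd hi⟩,
      ⟨h, hh, isSLEndo_of_injOn hsymW hhd fun i hi => hSL.injOn_right_of_tensorSum hbdV hgd hi⟩⟩
  · rintro ⟨⟨g, hg, hgSL⟩, ⟨h, hh, hhSL⟩⟩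
    exact ⟨g, hg, h, hh, isSLEndo_tensorSum hM.1 hN.1 hsymV hsymW hbdV hbdW
      (hM.mulMap_apply_mem hg) (hN.mulMap_apply_mem hh) hgSL hhSL⟩
end

section
/- Let K be a field, A = ⊕_{i=0}^{c} A_i a graded Artinian K-algebra, and y, z ∈ A_1 two linear forms of A. If y is a weak (respectively strong) Lefschetz element for A, then for all but finitely many λ ∈ K, the linear form y + λz is a weak (respectively strong) Lefschetz element for A. -/
set_option maxHeartbeats 1000000
set_option synthInstance.maxHeartbeats 400000

open TensorProduct

/-- If all matrix coefficients of a family `F` of endomorphisms of a finite dimensional space are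
polynomial in the parameter and `F 0` is injective, then so is `F lam` for almost all `lam`. -/
theorem finite_not_injective_of_polynomial_end {K V : Type*} [Field K] [AddCommGroup V]
    [Module K V] [FiniteDimensional K V] (F : K → V →ₗ[K] V)
    (hF : ∀ (v : V) (φ : V →ₗ[K] K), ∃ p : Polynomial K, ∀ lam, φ (F lam v) = p.eval lam)
    (h0 : Function.Injective (F 0)) :
    {lam : K | ¬ Function.Injective (F lam)}.Finite := by
  classical
  let b := Module.finBasis K V
  choose p hp using fun i j => hF (b j) (b.coord i)
  have hdet : ∀ lam, LinearMap.det (F lam) = (Matrix.det (Matrix.of p)).eval lam := by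
    intro lam
    rw [← LinearMap.det_toMatrix b, ← Polynomial.coe_evalRingHom, RingHom.map_det]
    congr 1
    ext i j
    simpa [LinearMap.toMatrix_apply] using hp i j lam
  have hinj : ∀ lam, LinearMap.det (F lam) ≠ 0 ↔ Function.Injective (F lam) := by
    intro lam
    rw [← isUnit_iff_ne_zero, ← LinearMap.isUnit_iff_isUnit_det, Module.End.isUnit_iff]
    exact ⟨fun h => h.1, fun h => ⟨h, LinearMap.injective_iff_surjective.1 h⟩⟩
  have hne : Matrix.det (Matrix.of p) ≠ 0 := by
    intro h
    exact (hinj 0).2 h0 (by rw [hdet, h, Polynomial.eval_zero])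
  refine (Polynomial.finite_setOfPred_isRoot hne).subset fun lam hlam => ?_
  by_contra h
  exact hlam ((hinj lam).1 (by rw [hdet]; exact h))

theorem finite_not_injective_of_polynomial {K V W : Type*} [Field K] [AddCommGroup V]
    [Module K V] [FiniteDimensional K V] [AddCommGroup W] [Module K W] (F : K → V →ₗ[K] W)
    (hF : ∀ (v : V) (φ : W →ₗ[K] K), ∃ p : Polynomial K, ∀ lam, φ (F lam v) = p.eval lam)
    (h0 : Function.Injective (F 0)) :
    {lam : K | ¬ Function.Injective (F lam)}.Finite := by
  obtain ⟨L, hL⟩ := (F 0).exists_leftInverse_of_injective (LinearMap.ker_eq_bot.2 h0)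
  refine (finite_not_injective_of_polynomial_end (fun lam => L ∘ₗ F lam)
    (fun v φ => hF v (φ ∘ₗ L)) ?_).subset fun lam hlam h => hlam ?_
  · rw [hL]
    exact Function.injective_id
  · exact Function.Injective.of_comp (f := L) (by simpa using h)

theorem finite_not_surjective_of_polynomial {K V W : Type*} [Field K] [AddCommGroup V]
    [Module K V] [AddCommGroup W] [Module K W] [FiniteDimensional K W] (F : K → V →ₗ[K] W)
    (hF : ∀ (v : V) (φ : W →ₗ[K] K), ∃ p : Polynomial K, ∀ lam, φ (F lam v) = p.eval lam)
    (h0 : Function.Surjective (F 0)) :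
    {lam : K | ¬ Function.Surjective (F lam)}.Finite := by
  obtain ⟨R, hR⟩ := (F 0).exists_rightInverse_of_surjective (LinearMap.range_eq_top.2 h0)
  refine (finite_not_injective_of_polynomial_end (fun lam => F lam ∘ₗ R)
    (fun w φ => hF (R w) φ) ?_).subset fun lam hlam h => hlam ?_
  · rw [hR]
    exact Function.injective_id
  · have hs : Function.Surjective (F lam ∘ₗ R) := LinearMap.injective_iff_surjective.1 h
    exact Function.Surjective.of_comp (g := R) (by simpa using hs)

theorem exists_polynomial_eval_eq_apply_add_smul_pow_mul {K A : Type*} [Field K] [CommRing A]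
    [Algebra K A] (y z : A) (φ : A →ₗ[K] K) (m : ℕ) (a : A) :
    ∃ p : Polynomial K, ∀ lam : K, φ ((y + lam • z) ^ m * a) = p.eval lam := by
  induction m generalizing a with
  | zero => exact ⟨Polynomial.C (φ a), by simp⟩
  | succ m ih =>
    obtain ⟨p, hp⟩ := ih (y * a)
    obtain ⟨q, hq⟩ := ih (z * a)
    refine ⟨p + Polynomial.X * q, fun lam => ?_⟩
    rw [Polynomial.eval_add, Polynomial.eval_mul, Polynomial.eval_X, ← hp, ← hq, pow_succ,
      mul_assoc, add_mul, smul_mul_assoc, mul_add, mul_smul_comm, map_add, map_smul, smul_eq_mul]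

section PowerMultiplication

variable {K A : Type*} [Field K] [CommRing A] [Algebra K A] {P Q : Submodule K A} {y z : A} {m : ℕ}

theorem exists_polynomial_restrict_mulLeft
    (hPQ : ∀ lam : K, ∀ v ∈ P, LinearMap.mulLeft K ((y + lam • z) ^ m) v ∈ Q)
    (v : P) (φ : Q →ₗ[K] K) :
    ∃ p : Polynomial K, ∀ lam : K,
      φ ((LinearMap.mulLeft K ((y + lam • z) ^ m)).restrict (hPQ lam) v) = p.eval lam := by
  obtain ⟨ψ, rfl⟩ := φ.exists_extend
  exact exists_polynomial_eval_eq_apply_add_smul_pow_mul y z ψ m v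

theorem finite_not_injOn_add_smul_pow_mul [FiniteDimensional K A]
    (hPQ : ∀ lam : K, ∀ v ∈ P, (y + lam • z) ^ m * v ∈ Q)
    (h0 : ∀ v ∈ P, y ^ m * v = 0 → v = 0) :
    {lam : K | ¬ ∀ v ∈ P, (y + lam • z) ^ m * v = 0 → v = 0}.Finite := by
  have key : ∀ lam : K, Function.Injective
      ((LinearMap.mulLeft K ((y + lam • z) ^ m)).restrict (hPQ lam)) ↔
      ∀ v ∈ P, (y + lam • z) ^ m * v = 0 → v = 0 := by
    intro lam
    rw [injective_iff_map_eq_zero]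
    simp only [Subtype.forall, Subtype.ext_iff]
    rfl
  simpa only [key] using finite_not_injective_of_polynomial _
    (exists_polynomial_restrict_mulLeft hPQ) ((key 0).2 (by simpa using h0))

theorem finite_not_surjOn_add_smul_pow_mul [FiniteDimensional K A]
    (hPQ : ∀ lam : K, ∀ v ∈ P, (y + lam • z) ^ m * v ∈ Q)
    (h0 : ∀ w ∈ Q, ∃ v ∈ P, y ^ m * v = w) :
    {lam : K | ¬ ∀ w ∈ Q, ∃ v ∈ P, (y + lam • z) ^ m * v = w}.Finite := by
  have key : ∀ lam : K, Function.Surjective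
      ((LinearMap.mulLeft K ((y + lam • z) ^ m)).restrict (hPQ lam)) ↔
      ∀ w ∈ Q, ∃ v ∈ P, (y + lam • z) ^ m * v = w := by
    intro lam
    constructor
    · intro h w hw
      obtain ⟨v, hv⟩ := h ⟨w, hw⟩
      exact ⟨v, v.2, congrArg Subtype.val hv⟩
    · rintro h ⟨w, hw⟩
      obtain ⟨v, hv, hvw⟩ := h w hw
      exact ⟨⟨v, hv⟩, Subtype.ext hvw⟩
  simpa only [key] using finite_not_surjective_of_polynomial _
    (exists_polynomial_restrict_mulLeft hPQ) ((key 0).2 (by simpa using h0))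

end PowerMultiplication

theorem pow_mul_mem_of_graded {K A : Type*} [Field K] [CommRing A] [Algebra K A]
    {𝒜 : ℕ → Submodule K A} (hmul : ∀ i j : ℕ, ∀ x ∈ 𝒜 i, ∀ y ∈ 𝒜 j, x * y ∈ 𝒜 (i + j))
    {g : A} (hg : g ∈ 𝒜 1) {i : ℕ} {v : A} (hv : v ∈ 𝒜 i) (m : ℕ) :
    g ^ m * v ∈ 𝒜 (i + m) := by
  induction m with
  | zero => simpa using hv
  | succ m ih =>
    rw [pow_succ', mul_assoc, show i + (m + 1) = 1 + (i + m) by omega]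
    exact hmul _ _ _ hg _ ih

/-- Lemma 4.4. Let `A = ⊕_{i=0}^{c} A_i` be a graded Artinian
`K`-algebra and `y, z ∈ A₁`.  If `y` is a weak (resp. strong) Lefschetz element
for `A`, then so is `y + λz` for all but finitely many `λ ∈ K`. -/
theorem statement_6 {K A : Type} [Field K] [CommRing A] [Algebra K A]
    (𝒜 : ℕ → Submodule K A) (c : ℕ)
    (hA : IsGradedArtinAlg K 𝒜) (htop : GradedTop K 𝒜 c)
    (y z : A) (hy : y ∈ 𝒜 1) (hz : z ∈ 𝒜 1) :
    (IsAlgWLElem K 𝒜 c y →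
      {lam : K | ¬ IsAlgWLElem K 𝒜 c (y + lam • z)}.Finite) ∧
    (IsAlgSLElem K 𝒜 c y →
      {lam : K | ¬ IsAlgSLElem K 𝒜 c (y + lam • z)}.Finite) := by
  obtain ⟨-, -, hmul, -, hfin⟩ := hA
  have hg : ∀ lam : K, y + lam • z ∈ 𝒜 1 := fun lam =>
    add_mem hy (Submodule.smul_mem _ _ hz)
  have hmem : ∀ (m i j : ℕ), i + m = j → ∀ lam : K, ∀ v ∈ 𝒜 i, (y + lam • z) ^ m * v ∈ 𝒜 j := by
    rintro m i _ rfl lam v hv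
    exact pow_mul_mem_of_graded hmul (hg lam) hv m
  constructor
  · rintro ⟨-, h⟩
    refine Set.Finite.subset (s := ⋃ i ∈ Set.Iic c, {lam : K | i + 1 ≤ c ∧
      ¬ ((∀ v ∈ 𝒜 i, (y + lam • z) * v = 0 → v = 0) ∨
        (∀ w ∈ 𝒜 (i + 1), ∃ v ∈ 𝒜 i, (y + lam • z) * v = w))}) ?_ ?_
    · refine (Set.finite_Iic c).biUnion fun i _ => ?_
      by_cases hi : i + 1 ≤ c
      · rcases h i hi with h | h
        · refine (finite_not_injOn_add_smul_pow_mul (hmem 1 i (i + 1) rfl)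
            (by simpa using h)).subset fun lam hlam h' => hlam.2 (Or.inl (by simpa using h'))
        · refine (finite_not_surjOn_add_smul_pow_mul (hmem 1 i (i + 1) rfl)
            (by simpa using h)).subset fun lam hlam h' => hlam.2 (Or.inr (by simpa using h'))
      · simp [hi]
    · intro lam hlam
      by_contra hcon
      refine hlam ⟨hg lam, fun i hi => ?_⟩
      by_contra hbad
      exact hcon (Set.mem_biUnion (Set.mem_Iic.2 (by omega : i ≤ c)) ⟨hi, hbad⟩)
  · rintro ⟨-, h⟩
    refine Set.Finite.subset (s := ⋃ i ∈ Set.Iic c, {lam : K | 2 * i ≤ c ∧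
      ¬ ((∀ v ∈ 𝒜 i, (y + lam • z) ^ (c - 2 * i) * v = 0 → v = 0) ∧
        (∀ w ∈ 𝒜 (c - i), ∃ v ∈ 𝒜 i, (y + lam • z) ^ (c - 2 * i) * v = w))}) ?_ ?_
    · refine (Set.finite_Iic c).biUnion fun i _ => ?_
      by_cases hi : 2 * i ≤ c
      · have hdeg := hmem (c - 2 * i) i (c - i) (by omega)
        refine ((finite_not_injOn_add_smul_pow_mul hdeg (h i hi).1).union
          (finite_not_surjOn_add_smul_pow_mul hdeg (h i hi).2)).subset fun lam hlam => ?_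
        exact not_and_or.1 hlam.2
      · simp [hi]
    · intro lam hlam
      by_contra hcon
      refine hlam ⟨hg lam, fun i hi => ?_⟩
      by_contra hbad
      exact hcon (Set.mem_biUnion (Set.mem_Iic.2 (by omega : i ≤ c)) ⟨hi, hbad⟩)
end

section
/- Let K be a field of characteristic zero and A a graded Artinian K-algebra. Then A has the WLP if and only if there exists a linear form z ∈ A_1 such that the associated graded ring Gr_{(z)}(A) has the WLP; and A has the SLP if and only if there exists a linear form z ∈ A_1 such that Gr_{(z)}(A) has the SLP. -/
set_option maxHeartbeats 1000000
set_option synthInstance.maxHeartbeats 400000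

open TensorProduct

section AssociatedGraded

variable (K : Type) [Field K]

/-- The `j`-th step `(z)^j` of the `(z)`-adic filtration of `A`, as a
`K`-submodule. -/
noncomputable def zpowFil {A : Type} [CommRing A] [Algebra K A] (z : A) (j : ℕ) :
    Submodule K A :=
  (Ideal.span {z} ^ j).restrictScalars K

/-- A realization of the associated graded ring `Gr_{(z)}(A)
= ⊕_j (z)^j/(z)^{j+1}` of `A` with respect to the `(z)`-adic filtration, as a
graded Artinian `K`-algebra `G`: a family of `K`-linear maps
`φ j : (z)^j → G` with kernel exactly `(z)^{j+1}`, jointly giving a direct sum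
decomposition of `G`, compatible with multiplication and sending elements of
`(z)^j ∩ A_d` into the degree-`d` piece of `G` (the grading inherited from
`A`). -/
structure GrRealization {A : Type} [CommRing A] [Algebra K A]
    (𝒜 : ℕ → Submodule K A) (z : A) : Type 1 where
  G : Type
  [commRing : CommRing G]
  [algebra : Algebra K G]
  grading : ℕ → Submodule K G
  isGradedAlg : IsGradedArtinAlg K grading
  φ : ∀ j : ℕ, ↥(zpowFil K z j) →ₗ[K] G
  ker_eq : ∀ (j : ℕ) (x : ↥(zpowFil K z j)),
    φ j x = 0 ↔ (x : A) ∈ zpowFil K z (j + 1)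
  map_one : ∀ h1 : (1 : A) ∈ zpowFil K z 0, φ 0 ⟨1, h1⟩ = 1
  map_mul : ∀ (i j : ℕ) (x y : A) (hx : x ∈ zpowFil K z i)
    (hy : y ∈ zpowFil K z j) (hxy : x * y ∈ zpowFil K z (i + j)),
    φ (i + j) ⟨x * y, hxy⟩ = φ i ⟨x, hx⟩ * φ j ⟨y, hy⟩
  grade_mem : ∀ (j d : ℕ) (x : A) (hx : x ∈ zpowFil K z j),
    x ∈ 𝒜 d → φ j ⟨x, hx⟩ ∈ grading d
  indep : iSupIndep fun j : ℕ => LinearMap.range (φ j)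
  spans : (⨆ j : ℕ, LinearMap.range (φ j)) = ⊤

attribute [instance] GrRealization.commRing GrRealization.algebra

end AssociatedGraded

section Generic

open Polynomial Filter

theorem eventually_eval_ne_zero {K : Type} [Field K] {p : K[X]} {t₀ : K} (h : p.eval t₀ ≠ 0) :
    ∀ᶠ t in cofinite, p.eval t ≠ 0 := by
  have hp : p ≠ 0 := by
    rintro rfl
    simp at h
  rw [eventually_cofinite]
  refine (Polynomial.finite_setOfPred_isRoot hp).subset fun t ht => ?_
  simpa using ht

theorem eventually_isUnit_map_eval {K n : Type} [Field K] [Fintype n] [DecidableEq n]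
    {P : Matrix n n K[X]} {t₀ : K} (h : P.map (evalRingHom t₀) = 1) :
    ∀ᶠ t in cofinite, IsUnit (P.map (evalRingHom t)) := by
  have key (t : K) : P.det.eval t = (P.map (evalRingHom t)).det :=
    RingHom.map_det (evalRingHom t) P
  have h0 : P.det.eval t₀ ≠ 0 := by
    rw [key, h]
    simp
  filter_upwards [eventually_eval_ne_zero h0] with t ht
  rw [Matrix.isUnit_iff_isUnit_det, isUnit_iff_ne_zero, ← key]
  exact ht

theorem map_C_map_evalRingHom {K m n : Type} [Field K] (N : Matrix m n K) (t : K) :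
    (N.map C).map (evalRingHom t) = N := by
  ext i j
  simp

theorem eventually_mulVec_injective {K m n : Type} [Field K] [Fintype m] [Fintype n]
    [DecidableEq n] {P : Matrix m n K[X]} {t₀ : K}
    (h : Function.Injective (P.map (evalRingHom t₀)).mulVec) :
    ∀ᶠ t in cofinite, Function.Injective (P.map (evalRingHom t)).mulVec := by
  classical
  obtain ⟨g, hg⟩ := LinearMap.exists_leftInverse_of_injective (P.map (evalRingHom t₀)).mulVecLin
    (LinearMap.ker_eq_bot.mpr h)
  have hN : LinearMap.toMatrix' g * P.map (evalRingHom t₀) = 1 := by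
    apply Matrix.toLin'.injective
    rw [Matrix.toLin'_mul, Matrix.toLin'_toMatrix', Matrix.toLin'_one]
    exact hg
  have := eventually_isUnit_map_eval (P := (LinearMap.toMatrix' g).map C * P) (t₀ := t₀)
    (by rw [Matrix.map_mul, map_C_map_evalRingHom, hN])
  filter_upwards [this] with t ht
  rw [Matrix.map_mul, map_C_map_evalRingHom] at ht
  intro v w hvw
  apply Matrix.mulVec_injective_of_isUnit ht
  simp only [← Matrix.mulVec_mulVec, hvw]

theorem eventually_mulVec_surjective {K m n : Type} [Field K] [Fintype m] [Fintype n]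
    [DecidableEq m] {P : Matrix m n K[X]} {t₀ : K}
    (h : Function.Surjective (P.map (evalRingHom t₀)).mulVec) :
    ∀ᶠ t in cofinite, Function.Surjective (P.map (evalRingHom t)).mulVec := by
  obtain ⟨N, hN⟩ := Matrix.mulVec_surjective_iff_exists_right_inverse.mp h
  have := eventually_isUnit_map_eval (P := P * N.map C) (t₀ := t₀)
    (by rw [Matrix.map_mul, map_C_map_evalRingHom, hN])
  filter_upwards [this] with t ht
  rw [Matrix.map_mul, map_C_map_evalRingHom] at ht
  obtain ⟨B, hB⟩ := isUnit_iff_exists_inv.mp ht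
  exact Matrix.mulVec_surjective_iff_exists_right_inverse.mpr
    ⟨N * B, by rw [← Matrix.mul_assoc, hB]⟩

theorem diagonal_mulVec_bijective {K n : Type} [Field K] [Fintype n] [DecidableEq n]
    {s : n → K} (hs : ∀ i, s i ≠ 0) : Function.Bijective (Matrix.diagonal s).mulVec := by
  have hu : IsUnit (Matrix.diagonal s) := by
    rw [Matrix.isUnit_iff_isUnit_det, Matrix.det_diagonal, isUnit_iff_ne_zero]
    exact Finset.prod_ne_zero_iff.mpr fun i _ => hs i
  exact ⟨Matrix.mulVec_injective_iff_isUnit.mpr hu, Matrix.mulVec_surjective_iff_isUnit.mpr hu⟩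

end Generic

section HomogeneousBasis

variable {K V ι : Type} [Field K] [AddCommGroup V] [Module K V]

theorem repr_eq_zero_of_mem_of_ne [Fintype ι] {N : ℕ → Submodule K V} (hN : iSupIndep N)
    (b : Module.Basis ι K V) {deg : ι → ℕ} (hb : ∀ i, b i ∈ N (deg i)) {n : ℕ} {x : V}
    (hx : x ∈ N n) {i : ι} (hi : deg i ≠ n) : b.repr x i = 0 := by
  classical
  set y := ∑ i, (if deg i = n then b.repr x i else 0) • b i with hy
  set y' := ∑ i, (if deg i = n then 0 else b.repr x i) • b i with hy'
  have hsum : y + y' = x := by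
    rw [hy, hy', ← Finset.sum_add_distrib]
    conv_rhs => rw [← b.sum_repr x]
    refine Finset.sum_congr rfl fun i _ => ?_
    split_ifs <;> simp
  have h1 : y ∈ N n := by
    refine Submodule.sum_mem _ fun i _ => ?_
    split_ifs with h
    · exact Submodule.smul_mem _ _ (h ▸ hb i)
    · simp
  have h2 : y' ∈ ⨆ m, ⨆ (_ : m ≠ n), N m := by
    refine Submodule.sum_mem _ fun i _ => ?_
    split_ifs with h
    · simp
    · exact Submodule.smul_mem _ _
        (Submodule.mem_iSup_of_mem (deg i) (Submodule.mem_iSup_of_mem h (hb i)))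
  have h3 : y' = 0 := by
    refine (Submodule.disjoint_def.mp (hN n)) y' ?_ h2
    rw [← eq_sub_iff_add_eq'] at hsum
    rw [hsum]
    exact Submodule.sub_mem _ hx h1
  simpa [hi] using Fintype.linearIndependent_iff.mp b.linearIndependent _ h3 i

theorem mem_iff_repr_eq_zero [Fintype ι] {N : ℕ → Submodule K V} (hN : iSupIndep N)
    (b : Module.Basis ι K V) {deg : ι → ℕ} (hb : ∀ i, b i ∈ N (deg i)) {n : ℕ} {x : V} :
    x ∈ N n ↔ ∀ i, deg i ≠ n → b.repr x i = 0 := by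
  refine ⟨fun hx i hi => repr_eq_zero_of_mem_of_ne hN b hb hx hi, fun h => ?_⟩
  rw [← b.sum_repr x]
  refine Submodule.sum_mem _ fun i _ => ?_
  by_cases hi : deg i = n
  · exact Submodule.smul_mem _ _ (hi ▸ hb i)
  · simp [h i hi]

theorem ne_bot_iff_exists_deg_eq [Fintype ι] {N : ℕ → Submodule K V} (hN : iSupIndep N)
    (b : Module.Basis ι K V) {deg : ι → ℕ} (hb : ∀ i, b i ∈ N (deg i)) {n : ℕ} :
    N n ≠ ⊥ ↔ ∃ i, deg i = n := by
  constructor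
  · intro h
    obtain ⟨x, hx, hx0⟩ := Submodule.exists_mem_ne_zero_of_ne_bot h
    by_contra! hne
    refine hx0 (b.ext_elem fun i => ?_)
    simpa using repr_eq_zero_of_mem_of_ne hN b hb hx (hne i)
  · rintro ⟨i, rfl⟩ h
    have := hb i
    rw [h, Submodule.mem_bot] at this
    exact b.ne_zero i this

/-- The coordinates on the degree `n` piece with respect to a homogeneous basis. -/
noncomputable def degreeEquiv [Fintype ι] {N : ℕ → Submodule K V} (hN : iSupIndep N)
    (b : Module.Basis ι K V) {deg : ι → ℕ} (hb : ∀ i, b i ∈ N (deg i)) (n : ℕ) :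
    N n ≃ ({i // deg i = n} → K) where
  toFun x i := b.repr x i
  invFun c := ⟨b.equivFun.symm fun i => if h : deg i = n then c ⟨i, h⟩ else 0, by
    rw [mem_iff_repr_eq_zero hN b hb]
    intro i hi
    rw [← b.equivFun_apply, LinearEquiv.apply_symm_apply, dif_neg hi]⟩
  left_inv x := by
    apply Subtype.ext
    rw [LinearEquiv.symm_apply_eq]
    ext i
    rw [b.equivFun_apply]
    split_ifs with h
    · rfl
    · exact (repr_eq_zero_of_mem_of_ne hN b hb x.2 h).symm
  right_inv c := by
    ext i
    simp only
    rw [← b.equivFun_apply, LinearEquiv.apply_symm_apply, dif_pos i.2]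

variable [Fintype ι] [DecidableEq ι]

/-- The block of a square matrix with columns of degree `n` and rows of degree `m`. -/
def degreeBlock {R : Type} (deg : ι → ℕ) (n m : ℕ) (M : Matrix ι ι R) :
    Matrix {i // deg i = m} {i // deg i = n} R :=
  M.submatrix Subtype.val Subtype.val

theorem degreeBlock_mulVec_degreeEquiv {N : ℕ → Submodule K V} (hN : iSupIndep N)
    (b : Module.Basis ι K V) {deg : ι → ℕ} (hb : ∀ i, b i ∈ N (deg i)) {n m : ℕ}
    {f : V →ₗ[K] V} (hf : ∀ x ∈ N n, f x ∈ N m) (x : N n) :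
    (degreeBlock deg n m (LinearMap.toMatrix b b f)).mulVec (degreeEquiv hN b hb n x) =
      degreeEquiv hN b hb m ⟨f x, hf x x.2⟩ := by
  ext i
  change _ = b.repr (f x) i
  rw [← LinearMap.toMatrix_mulVec_repr b b f]
  refine Fintype.sum_of_injective Subtype.val Subtype.val_injective _ _ (fun j hj => ?_)
    fun j => rfl
  rw [repr_eq_zero_of_mem_of_ne hN b hb x.2 (by simpa using hj), mul_zero]

theorem degreeBlock_mulVec_injective_iff {N : ℕ → Submodule K V} (hN : iSupIndep N)
    (b : Module.Basis ι K V) {deg : ι → ℕ} (hb : ∀ i, b i ∈ N (deg i)) {n m : ℕ}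
    {f : V →ₗ[K] V} (hf : ∀ x ∈ N n, f x ∈ N m) :
    Function.Injective (degreeBlock deg n m (LinearMap.toMatrix b b f)).mulVec ↔
      ∀ x ∈ N n, f x = 0 → x = 0 := by
  have h1 : (degreeBlock deg n m (LinearMap.toMatrix b b f)).mulVec ∘ degreeEquiv hN b hb n =
      degreeEquiv hN b hb m ∘ f.restrict hf :=
    funext fun x => degreeBlock_mulVec_degreeEquiv hN b hb hf x
  rw [← (degreeEquiv hN b hb n).injective_comp, h1, (degreeEquiv hN b hb m).comp_injective,
    injective_iff_map_eq_zero]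
  constructor
  · intro h x hx h0
    exact congrArg Subtype.val (h ⟨x, hx⟩ (Subtype.ext h0))
  · rintro h ⟨x, hx⟩ h0
    exact Subtype.ext (h x hx (congrArg Subtype.val h0))

theorem degreeBlock_mulVec_surjective_iff {N : ℕ → Submodule K V} (hN : iSupIndep N)
    (b : Module.Basis ι K V) {deg : ι → ℕ} (hb : ∀ i, b i ∈ N (deg i)) {n m : ℕ}
    {f : V →ₗ[K] V} (hf : ∀ x ∈ N n, f x ∈ N m) :
    Function.Surjective (degreeBlock deg n m (LinearMap.toMatrix b b f)).mulVec ↔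
      ∀ y ∈ N m, ∃ x ∈ N n, f x = y := by
  have h1 : (degreeBlock deg n m (LinearMap.toMatrix b b f)).mulVec ∘ degreeEquiv hN b hb n =
      degreeEquiv hN b hb m ∘ f.restrict hf :=
    funext fun x => degreeBlock_mulVec_degreeEquiv hN b hb hf x
  rw [← (degreeEquiv hN b hb n).surjective_comp, h1, (degreeEquiv hN b hb m).comp_surjective]
  constructor
  · intro h y hy
    obtain ⟨x, hx⟩ := h ⟨y, hy⟩
    exact ⟨x, x.2, congrArg Subtype.val hx⟩
  · rintro h ⟨y, hy⟩
    obtain ⟨x, hx, rfl⟩ := h y hy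
    exact ⟨⟨x, hx⟩, rfl⟩

end HomogeneousBasis

section FilteredBasis

variable {K A G ι : Type} [Field K] [AddCommGroup A] [Module K A] [AddCommGroup G] [Module K G]
  [Fintype ι] {F : ℕ → Submodule K A} {ψ : ℕ → A →ₗ[K] G} {b : Module.Basis ι K G}
  {ord : ι → ℕ} {e : ι → A}

theorem sum_smul_mem_filtration (hF : Antitone F) (heF : ∀ i, e i ∈ F (ord i)) {n : ℕ}
    {c : ι → K} (hc : ∀ i, ord i < n → c i = 0) : ∑ i, c i • e i ∈ F n := by
  refine Submodule.sum_mem _ fun i _ => ?_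
  by_cases h : ord i < n
  · simp [hc i h]
  · exact Submodule.smul_mem _ _ (hF (not_lt.mp h) (heF i))

theorem initialForm_sum_smul (hF : Antitone F)
    (hker : ∀ n, ∀ x ∈ F n, ψ n x = 0 ↔ x ∈ F (n + 1))
    (hb : ∀ i, b i = ψ (ord i) (e i)) (heF : ∀ i, e i ∈ F (ord i)) {n : ℕ}
    {c : ι → K} (hc : ∀ i, ord i < n → c i = 0) :
    ψ n (∑ i, c i • e i) = ∑ i, (if ord i = n then c i else 0) • b i := by
  rw [map_sum]
  refine Finset.sum_congr rfl fun i _ => ?_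
  rw [map_smul]
  split_ifs with h
  · rw [hb, h]
  · rcases lt_or_gt_of_ne h with h | h
    · simp [hc i h]
    · have := heF i
      rw [(hker n _ (hF h.le this)).mpr (hF h this), smul_zero, zero_smul]

theorem linearIndependent_of_initialForm (hF : Antitone F)
    (hker : ∀ n, ∀ x ∈ F n, ψ n x = 0 ↔ x ∈ F (n + 1))
    (hb : ∀ i, b i = ψ (ord i) (e i)) (heF : ∀ i, e i ∈ F (ord i)) :
    LinearIndependent K e := by
  rw [Fintype.linearIndependent_iff]
  intro c hc
  have key : ∀ n, ∀ i, ord i < n → c i = 0 := by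
    intro n
    induction n with
    | zero => simp
    | succ n ih =>
      have h := initialForm_sum_smul hF hker hb heF ih
      rw [hc, map_zero] at h
      have h' := Fintype.linearIndependent_iff.mp b.linearIndependent _ h.symm
      intro i hi
      rcases Nat.lt_succ_iff_lt_or_eq.mp hi with hi | hi
      · exact ih i hi
      · simpa [hi] using h' i
  exact fun i => key (ord i + 1) i (Nat.lt_succ_self _)

theorem exists_sum_smul_eq_of_mem_filtration (hF : Antitone F) {p : ℕ} (hp : F p = ⊥)
    (hker : ∀ n, ∀ x ∈ F n, ψ n x = 0 ↔ x ∈ F (n + 1))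
    (hindep : iSupIndep fun n => (F n).map (ψ n))
    (hb : ∀ i, b i = ψ (ord i) (e i)) (heF : ∀ i, e i ∈ F (ord i)) {n : ℕ} {x : A}
    (hx : x ∈ F n) : ∃ c : ι → K, (∀ i, ord i < n → c i = 0) ∧ ∑ i, c i • e i = x := by
  rcases le_total p n with hpn | hnp
  · have := hF hpn hx
    rw [hp, Submodule.mem_bot] at this
    exact ⟨0, by simp, by simp [this]⟩
  induction hnp using Nat.decreasingInduction generalizing x with
  | self =>
    rw [hp, Submodule.mem_bot] at hx
    exact ⟨0, by simp, by simp [hx]⟩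
  | of_succ n hn ih =>
    have hbm (i) : b i ∈ (F (ord i)).map (ψ (ord i)) := hb i ▸ Submodule.mem_map_of_mem (heF i)
    set c := b.repr (ψ n x)
    have hc (i) (hi : ord i ≠ n) : c i = 0 :=
      repr_eq_zero_of_mem_of_ne hindep b hbm (Submodule.mem_map_of_mem hx) hi
    have hc' (i) (hi : ord i < n) : c i = 0 := hc i hi.ne
    have hs := sum_smul_mem_filtration hF heF hc'
    have hψ : ψ n (∑ i, c i • e i) = ψ n x := by
      rw [initialForm_sum_smul hF hker hb heF hc', ← b.sum_repr (ψ n x)]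
      refine Finset.sum_congr rfl fun i _ => ?_
      split_ifs with h
      · rfl
      · rw [← hc i h]
    have hmem : x - ∑ i, c i • e i ∈ F (n + 1) := by
      rw [← hker n _ (Submodule.sub_mem _ hx hs), map_sub, hψ, sub_self]
    obtain ⟨c', h0, h1⟩ := ih hmem
    refine ⟨fun i => c i + c' i, fun i hi => ?_, ?_⟩
    · simp only [hc' i hi, h0 i (hi.trans n.lt_succ_self), add_zero]
    · simp only [add_smul, Finset.sum_add_distrib, h1, add_sub_cancel]

/-- Lifting a basis of the associated graded space gives an adapted basis of the filtered space. -/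
theorem exists_adapted_basis (hF : Antitone F) (h0 : F 0 = ⊤) {p : ℕ} (hp : F p = ⊥)
    (hker : ∀ n, ∀ x ∈ F n, ψ n x = 0 ↔ x ∈ F (n + 1))
    (hindep : iSupIndep fun n => (F n).map (ψ n))
    (hb : ∀ i, b i = ψ (ord i) (e i)) (heF : ∀ i, e i ∈ F (ord i)) :
    ∃ B : Module.Basis ι K A, (∀ i, B i = e i) ∧
      (∀ n, ∀ x ∈ F n, ∀ i, ord i < n → B.repr x i = 0) ∧
      ∀ n, ∀ x ∈ F n, ∀ i, b.repr (ψ n x) i = if ord i = n then B.repr x i else 0 := by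
  have hex {n : ℕ} {x : A} (hx : x ∈ F n) :=
    exists_sum_smul_eq_of_mem_filtration hF hp hker hindep hb heF hx
  let B : Module.Basis ι K A := Module.Basis.mk
    (linearIndependent_of_initialForm hF hker hb heF) <| by
    intro x _
    obtain ⟨c, -, rfl⟩ := hex (n := 0) (x := x) (by simp [h0])
    exact Submodule.sum_mem _ fun i _ => Submodule.smul_mem _ _
      (Submodule.subset_span (Set.mem_range_self i))
  have hB (i) : B i = e i := Module.Basis.mk_apply _ _ i
  have hrepr (c : ι → K) (i) : B.repr (∑ i, c i • e i) i = c i := by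
    simp only [← hB, B.repr_sum_self]
  refine ⟨B, hB, fun n x hx i hi => ?_, fun n x hx i => ?_⟩
  · obtain ⟨c, hc, rfl⟩ := hex hx
    rw [hrepr, hc i hi]
  · obtain ⟨c, hc, rfl⟩ := hex hx
    rw [hrepr, initialForm_sum_smul hF hker hb heF hc, b.repr_sum_self]

end FilteredBasis

section Deformation

open Polynomial Filter

variable {K ι : Type} [Field K]

/-- The one-parameter family of matrices joining the initial form of `α + l • β` (at `0`) to
conjugates of `α + (l * t⁻¹) • β` (at `t ≠ 0`). -/
noncomputable def deformation (ord : ι → ℕ) (α β : Matrix ι ι K) (l : K) : Matrix ι ι K[X] :=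
  Matrix.of fun i' i =>
    C (α i' i) * X ^ (ord i' - ord i) + C (l * β i' i) * X ^ (ord i' - ord i - 1)

variable {ord : ι → ℕ} {α β : Matrix ι ι K}

theorem deformation_map_eval_zero (hα : ∀ i' i, ord i' < ord i → α i' i = 0)
    (hβ : ∀ i' i, ord i' < ord i + 1 → β i' i = 0) (l : K) (i' i : ι) :
    (deformation ord α β l).map (evalRingHom 0) i' i =
      (if ord i' = ord i then α i' i else 0) + l * (if ord i' = ord i + 1 then β i' i else 0) := by
  have h1 : α i' i * 0 ^ (ord i' - ord i) = if ord i' = ord i then α i' i else 0 := by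
    split_ifs with h
    · simp [h]
    · rcases lt_or_gt_of_ne h with h | h
      · simp [hα i' i h]
      · rw [zero_pow (by omega), mul_zero]
  have h2 : β i' i * 0 ^ (ord i' - ord i - 1) = if ord i' = ord i + 1 then β i' i else 0 := by
    split_ifs with h
    · simp [h]
    · rcases lt_or_gt_of_ne h with h | h
      · simp [hβ i' i h]
      · rw [zero_pow (by omega), mul_zero]
  simp [deformation, ← h1, ← h2, mul_assoc]

variable [Fintype ι] [DecidableEq ι]

theorem diagonal_mul_eq_deformation_mul (hα : ∀ i' i, ord i' < ord i → α i' i = 0)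
    (hβ : ∀ i' i, ord i' < ord i + 1 → β i' i = 0) (l : K) {t : K} (ht : t ≠ 0) :
    Matrix.diagonal (fun i => t ^ ord i) * (α + (l * t⁻¹) • β) =
      (deformation ord α β l).map (evalRingHom t) * Matrix.diagonal (fun i => t ^ ord i) := by
  ext i' i
  have h1 : t ^ ord i' * α i' i = α i' i * t ^ (ord i' - ord i) * t ^ ord i := by
    rcases lt_or_ge (ord i') (ord i) with h | h
    · simp [hα i' i h]
    · rw [mul_assoc, ← pow_add, Nat.sub_add_cancel h, mul_comm]
  have h2 : t ^ ord i' * (t⁻¹ * β i' i) = β i' i * t ^ (ord i' - ord i - 1) * t ^ ord i := by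
    rcases lt_or_ge (ord i') (ord i + 1) with h | h
    · simp [hβ i' i h]
    · have : ord i' = (ord i' - ord i - 1) + ord i + 1 := by omega
      rw [mul_assoc, ← pow_add]
      nth_rewrite 1 [this]
      rw [pow_succ]
      field_simp
  simp only [deformation, Matrix.diagonal_mul, Matrix.mul_diagonal, Matrix.add_apply,
    Matrix.smul_apply, Matrix.map_apply, Matrix.of_apply, coe_evalRingHom, eval_add, eval_mul,
    eval_C, eval_pow, eval_X, smul_eq_mul]
  linear_combination h1 + l * h2

theorem mulVec_eq_diagonal_comp {m n : Type} [Fintype m] [Fintype n] [DecidableEq m]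
    [DecidableEq n] {M N : Matrix m n K} {u : m → K} {w : n → K}
    (h : ∀ i j, M i j = u i * N i j * w j) :
    M.mulVec = (Matrix.diagonal u).mulVec ∘ N.mulVec ∘ (Matrix.diagonal w).mulVec := by
  have : M = Matrix.diagonal u * (N * Matrix.diagonal w) := by
    ext i j
    simp [h, mul_assoc]
  funext v
  simp [this, Matrix.mulVec_mulVec]

theorem degreeBlock_pow_eq_comp (hα : ∀ i' i, ord i' < ord i → α i' i = 0)
    (hβ : ∀ i' i, ord i' < ord i + 1 → β i' i = 0) (l : K) {t : K} (ht : t ≠ 0)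
    (deg : ι → ℕ) (n m k : ℕ) :
    (degreeBlock deg n m ((α + (l * t⁻¹) • β) ^ k)).mulVec =
      (Matrix.diagonal fun i : {i // deg i = m} => (t ^ ord i.1)⁻¹).mulVec ∘
        ((degreeBlock deg n m (deformation ord α β l ^ k)).map (evalRingHom t)).mulVec ∘
          (Matrix.diagonal fun i : {i // deg i = n} => t ^ ord i.1).mulVec := by
  apply mulVec_eq_diagonal_comp
  rintro ⟨i', hi'⟩ ⟨i, hi⟩
  have hsc : SemiconjBy (Matrix.diagonal (fun i => t ^ ord i)) (α + (l * t⁻¹) • β)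
    ((deformation ord α β l).map (evalRingHom t)) := diagonal_mul_eq_deformation_mul hα hβ l ht
  have hk := congrFun (congrFun (hsc.pow_right k).eq i') i
  have hmap : (deformation ord α β l).map (evalRingHom t) ^ k =
      (deformation ord α β l ^ k).map (evalRingHom t) :=
    (map_pow (evalRingHom t).mapMatrix _ k).symm
  rw [hmap, Matrix.diagonal_mul, Matrix.mul_diagonal] at hk
  simp only [degreeBlock, Matrix.submatrix_apply, Matrix.map_apply] at hk ⊢
  rw [mul_assoc, ← hk, inv_mul_cancel_left₀ (pow_ne_zero _ ht)]

theorem eventually_degreeBlock_injective (hα : ∀ i' i, ord i' < ord i → α i' i = 0)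
    (hβ : ∀ i' i, ord i' < ord i + 1 → β i' i = 0) (l : K) (deg : ι → ℕ) (n m k : ℕ)
    (h : Function.Injective (degreeBlock deg n m
      ((deformation ord α β l).map (evalRingHom 0) ^ k)).mulVec) :
    ∀ᶠ t in cofinite,
      Function.Injective (degreeBlock deg n m ((α + (l * t⁻¹) • β) ^ k)).mulVec := by
  have hmap : (deformation ord α β l).map (evalRingHom 0) ^ k =
      (deformation ord α β l ^ k).map (evalRingHom 0) :=
    (map_pow (evalRingHom 0).mapMatrix _ k).symm
  rw [hmap] at h
  filter_upwards [eventually_mulVec_injective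
    (P := degreeBlock deg n m (deformation ord α β l ^ k)) h, eventually_cofinite_ne 0] with t h ht
  rw [degreeBlock_pow_eq_comp hα hβ l ht]
  exact (diagonal_mulVec_bijective fun i => inv_ne_zero (pow_ne_zero _ ht)).injective.comp
    (h.comp (diagonal_mulVec_bijective fun i => pow_ne_zero _ ht).injective)

theorem eventually_degreeBlock_surjective (hα : ∀ i' i, ord i' < ord i → α i' i = 0)
    (hβ : ∀ i' i, ord i' < ord i + 1 → β i' i = 0) (l : K) (deg : ι → ℕ) (n m k : ℕ)
    (h : Function.Surjective (degreeBlock deg n m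
      ((deformation ord α β l).map (evalRingHom 0) ^ k)).mulVec) :
    ∀ᶠ t in cofinite,
      Function.Surjective (degreeBlock deg n m ((α + (l * t⁻¹) • β) ^ k)).mulVec := by
  have hmap : (deformation ord α β l).map (evalRingHom 0) ^ k =
      (deformation ord α β l ^ k).map (evalRingHom 0) :=
    (map_pow (evalRingHom 0).mapMatrix _ k).symm
  rw [hmap] at h
  filter_upwards [eventually_mulVec_surjective
    (P := degreeBlock deg n m (deformation ord α β l ^ k)) h, eventually_cofinite_ne 0] with t h ht
  rw [degreeBlock_pow_eq_comp hα hβ l ht]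
  exact (diagonal_mulVec_bijective fun i => inv_ne_zero (pow_ne_zero _ ht)).surjective.comp
    (h.comp (diagonal_mulVec_bijective fun i => pow_ne_zero _ ht).surjective)

end Deformation

section GradedAlgebra

variable {K A : Type} [Field K] [CommRing A] [Algebra K A] {𝒜 : ℕ → Submodule K A}

theorem IsGradedArtinAlg.pow_mem (h : IsGradedArtinAlg K 𝒜) {x : A} {d : ℕ} (hx : x ∈ 𝒜 d)
    (k : ℕ) : x ^ k ∈ 𝒜 (k * d) := by
  induction k with
  | zero => simpa using h.2.1
  | succ k ih =>
    rw [pow_succ, Nat.succ_mul]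
    exact h.2.2.1 _ _ _ ih _ hx

theorem IsGradedArtinAlg.pow_mul_mem (h : IsGradedArtinAlg K 𝒜) {x y : A} (hx : x ∈ 𝒜 1)
    {n : ℕ} (hy : y ∈ 𝒜 n) (k : ℕ) : x ^ k * y ∈ 𝒜 (n + k) := by
  have := h.2.2.1 _ _ _ (h.pow_mem hx k) _ hy
  rwa [mul_one, add_comm] at this

variable {ι : Type} [Fintype ι] [DecidableEq ι]

theorem IsGradedArtinAlg.degreeBlock_injective_iff (h : IsGradedArtinAlg K 𝒜)
    (b : Module.Basis ι K A) {deg : ι → ℕ} (hb : ∀ i, b i ∈ 𝒜 (deg i)) {x : A} (hx : x ∈ 𝒜 1)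
    (n k : ℕ) :
    Function.Injective (degreeBlock deg n (n + k) (Algebra.leftMulMatrix b x ^ k)).mulVec ↔
      ∀ v ∈ 𝒜 n, x ^ k * v = 0 → v = 0 := by
  rw [← map_pow, Algebra.leftMulMatrix_apply]
  exact degreeBlock_mulVec_injective_iff h.1.submodule_iSupIndep b hb
    fun y hy => h.pow_mul_mem hx hy k

theorem IsGradedArtinAlg.degreeBlock_surjective_iff (h : IsGradedArtinAlg K 𝒜)
    (b : Module.Basis ι K A) {deg : ι → ℕ} (hb : ∀ i, b i ∈ 𝒜 (deg i)) {x : A} (hx : x ∈ 𝒜 1)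
    (n k : ℕ) :
    Function.Surjective (degreeBlock deg n (n + k) (Algebra.leftMulMatrix b x ^ k)).mulVec ↔
      ∀ w ∈ 𝒜 (n + k), ∃ v ∈ 𝒜 n, x ^ k * v = w := by
  rw [← map_pow, Algebra.leftMulMatrix_apply]
  exact degreeBlock_mulVec_surjective_iff h.1.submodule_iSupIndep b hb
    fun y hy => h.pow_mul_mem hx hy k

/-- An element of `(z)^j` of degree `d` is zero or `z ^ j` times an element of degree `d - j`. -/
theorem IsGradedArtinAlg.pow_mul_homogeneous (h : IsGradedArtinAlg K 𝒜) {z : A} (hz : z ∈ 𝒜 1)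
    (j d : ℕ) {y : A} (hy : z ^ j * y ∈ 𝒜 d) :
    z ^ j * y = 0 ∨ j ≤ d ∧ ∃ y' ∈ 𝒜 (d - j), z ^ j * y = z ^ j * y' := by
  let _ : DirectSum.Decomposition 𝒜 := h.1.chooseDecomposition
  let _ : GradedRing 𝒜 :=
    { one_mem := h.2.1, mul_mem := fun {i j x y} hx hy => h.2.2.1 i j x hx y hy }
  have hzj : z ^ j ∈ 𝒜 j := by simpa using h.pow_mem hz j
  have key := DirectSum.coe_decompose_mul_of_left_mem 𝒜 d (b := y) hzj
  rw [DirectSum.decompose_of_mem_same 𝒜 hy] at key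
  split_ifs at key with hjd
  · exact Or.inr ⟨hjd, _, SetLike.coe_mem _, key⟩
  · exact Or.inl key

theorem mem_zpowFil {z : A} {j : ℕ} {x : A} : x ∈ zpowFil K z j ↔ ∃ y, x = z ^ j * y := by
  rw [zpowFil, Submodule.restrictScalars_mem, Ideal.span_singleton_pow,
    Ideal.mem_span_singleton, dvd_def]

theorem zpowFil_antitone (z : A) : Antitone (zpowFil K z) :=
  fun _ _ hij _ hx => Ideal.pow_le_pow_right hij hx

theorem zpowFil_zero (z : A) : zpowFil K z 0 = ⊤ := by
  simp [zpowFil]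

theorem mul_mem_zpowFil {z x y : A} {i j : ℕ} (hx : x ∈ zpowFil K z i)
    (hy : y ∈ zpowFil K z j) : x * y ∈ zpowFil K z (i + j) := by
  obtain ⟨x, rfl⟩ := mem_zpowFil.mp hx
  obtain ⟨y, rfl⟩ := mem_zpowFil.mp hy
  exact mem_zpowFil.mpr ⟨x * y, by ring⟩

theorem IsGradedArtinAlg.exists_zpowFil_eq_bot (h : IsGradedArtinAlg K 𝒜) {z : A}
    (hz : z ∈ 𝒜 1) : ∃ p, zpowFil K z p = ⊥ := by
  have := h.2.2.2.2
  have hfin := WellFoundedGT.finite_ne_bot_of_iSupIndep h.1.submodule_iSupIndep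
  obtain ⟨p, hp⟩ := hfin.exists_notMem
  have hp : 𝒜 p = ⊥ := by simpa using hp
  have hzp : z ^ p ∈ 𝒜 p := by simpa using h.pow_mem hz p
  rw [hp, Submodule.mem_bot] at hzp
  refine ⟨p, (Submodule.eq_bot_iff _).mpr fun x hx => ?_⟩
  obtain ⟨y, rfl⟩ := mem_zpowFil.mp hx
  rw [hzp, zero_mul]

theorem IsGradedArtinAlg.zpowFil_le_iSup (h : IsGradedArtinAlg K 𝒜) {z : A} (hz : z ∈ 𝒜 1)
    (j : ℕ) : zpowFil K z j ≤ ⨆ d, zpowFil K z j ⊓ 𝒜 d := by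
  intro x hx
  obtain ⟨y, rfl⟩ := mem_zpowFil.mp hx
  have hy : y ∈ ⨆ d, 𝒜 d := h.1.submodule_iSup_eq_top ▸ Submodule.mem_top
  clear hx
  induction hy using Submodule.iSup_induction' with
  | mem d y hy =>
    refine Submodule.mem_iSup_of_mem (d + j) ⟨mem_zpowFil.mpr ⟨y, rfl⟩, h.pow_mul_mem hz hy j⟩
  | zero => simp
  | add x y _ _ hx hy =>
    rw [mul_add]
    exact Submodule.add_mem _ hx hy

end GradedAlgebra

section Transfer

open Filter

variable {K A : Type} [Field K] [CommRing A] [Algebra K A] {𝒜 : ℕ → Submodule K A} {z : A}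

namespace GrRealization

theorem exists_linear_extension (Gr : GrRealization K 𝒜 z) :
    ∃ ψ : ℕ → A →ₗ[K] Gr.G, ∀ j x (hx : x ∈ zpowFil K z j), ψ j x = Gr.φ j ⟨x, hx⟩ := by
  choose ψ hψ using fun j => LinearMap.exists_extend (Gr.φ j)
  exact ⟨ψ, fun j x hx => LinearMap.congr_fun (hψ j) ⟨x, hx⟩⟩

/-- An adapted homogeneous basis of `A`, together with its image in the associated graded ring. -/
theorem exists_homogeneous_adapted_basis (Gr : GrRealization K 𝒜 z) (hA : IsGradedArtinAlg K 𝒜)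
    (hz : z ∈ 𝒜 1) {ψ : ℕ → A →ₗ[K] Gr.G}
    (hψ : ∀ j x (hx : x ∈ zpowFil K z j), ψ j x = Gr.φ j ⟨x, hx⟩) :
    ∃ (ι : Type) (_ : Fintype ι) (ord deg : ι → ℕ) (B : Module.Basis ι K A)
      (b : Module.Basis ι K Gr.G),
      (∀ i, B i ∈ 𝒜 (deg i)) ∧ (∀ i, b i ∈ Gr.grading (deg i)) ∧
      (∀ i, B i ∈ zpowFil K z (ord i)) ∧ (∀ i, b i = ψ (ord i) (B i)) ∧
      (∀ n, ∀ x ∈ zpowFil K z n, ∀ i, ord i < n → B.repr x i = 0) ∧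
      ∀ n, ∀ x ∈ zpowFil K z n, ∀ i,
        b.repr (ψ n x) i = if ord i = n then B.repr x i else 0 := by
  have hmap (n : ℕ) : (zpowFil K z n).map (ψ n) = LinearMap.range (Gr.φ n) := by
    ext y
    constructor
    · rintro ⟨x, hx, rfl⟩
      exact ⟨⟨x, hx⟩, (hψ n x hx).symm⟩
    · rintro ⟨⟨x, hx⟩, rfl⟩
      exact ⟨x, hx, hψ n x hx⟩
  have hker : ∀ n, ∀ x ∈ zpowFil K z n, ψ n x = 0 ↔ x ∈ zpowFil K z (n + 1) := by
    intro n x hx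
    rw [hψ n x hx, Gr.ker_eq]
  have hindep : iSupIndep fun n => (zpowFil K z n).map (ψ n) := by
    simpa only [hmap] using Gr.indep
  obtain ⟨p, hp⟩ := hA.exists_zpowFil_eq_bot hz
  have hspan : ⊤ ≤ Submodule.span K
      {y : Gr.G | ∃ j d x, x ∈ zpowFil K z j ∧ x ∈ 𝒜 d ∧ y = ψ j x} := by
    rw [← Gr.spans]
    refine iSup_le fun j => ?_
    rw [← hmap]
    refine (Submodule.map_mono (hA.zpowFil_le_iSup hz j)).trans ?_
    rw [Submodule.map_iSup]
    refine iSup_le fun d => ?_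
    rintro _ ⟨x, ⟨hx, hx'⟩, rfl⟩
    exact Submodule.subset_span ⟨j, d, x, hx, hx', rfl⟩
  let b := Module.Basis.ofSpan hspan
  have := Gr.isGradedAlg.2.2.2.2
  have hb (i) := Module.Basis.ofSpan_subset hspan (Set.mem_range_self i)
  choose ord deg e heF heA hbe using hb
  have hfin := @Fintype.ofFinite _ (Module.Finite.finite_basis b)
  obtain ⟨B, hB, hB1, hB2⟩ := exists_adapted_basis (b := b) (zpowFil_antitone z)
    (zpowFil_zero z) hp hker hindep hbe heF
  refine ⟨_, hfin, ord, deg, B, b, fun i => ?_, fun i => ?_, fun i => ?_, fun i => ?_, hB1, hB2⟩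
  · rw [hB]
    exact heA i
  · rw [hbe, hψ _ _ (heF i)]
    exact Gr.grade_mem _ _ _ _ (heA i)
  · rw [hB]
    exact heF i
  · rw [hB]
    exact hbe i

/-- Degree one elements of `Gr_{(z)}(A)` are sums of an initial form of degree `0` and a multiple
of the initial form of `z`. -/
theorem exists_eq_of_mem_grading_one (Gr : GrRealization K 𝒜 z) (hA : IsGradedArtinAlg K 𝒜)
    (hz : z ∈ 𝒜 1) {ψ : ℕ → A →ₗ[K] Gr.G}
    (hψ : ∀ j x (hx : x ∈ zpowFil K z j), ψ j x = Gr.φ j ⟨x, hx⟩) {g : Gr.G}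
    (hg : g ∈ Gr.grading 1) : ∃ a ∈ 𝒜 1, ∃ l : K, g = ψ 0 a + l • ψ 1 z := by
  obtain ⟨ι, _, ord, deg, B, b, hBA, hbG, hBF, hbB, -, -⟩ :=
    Gr.exists_homogeneous_adapted_basis hA hz hψ
  suffices h : g ∈ (𝒜 1).map (ψ 0) ⊔ Submodule.span K {ψ 1 z} by
    obtain ⟨_, ⟨a, ha, rfl⟩, y, hy, rfl⟩ := Submodule.mem_sup.mp h
    obtain ⟨l, rfl⟩ := Submodule.mem_span_singleton.mp hy
    exact ⟨a, ha, l, rfl⟩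
  rw [← b.sum_repr g]
  refine Submodule.sum_mem _ fun i _ => ?_
  by_cases hi : deg i = 1
  swap
  · rw [repr_eq_zero_of_mem_of_ne Gr.isGradedAlg.1.submodule_iSupIndep b hbG hg hi, zero_smul]
    exact Submodule.zero_mem _
  refine Submodule.smul_mem _ _ ?_
  have hA1 : B i ∈ 𝒜 1 := hi ▸ hBA i
  obtain ⟨y, hy⟩ := mem_zpowFil.mp (hBF i)
  rcases hA.pow_mul_homogeneous hz _ _ (hy ▸ hA1) with h0 | ⟨hle, y', hy', h⟩
  · exact absurd (hy.trans h0) (B.ne_zero i)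
  · rw [hbB]
    rcases Nat.le_one_iff_eq_zero_or_eq_one.mp hle with h' | h'
    · rw [h']
      exact Submodule.mem_sup_left (Submodule.mem_map_of_mem hA1)
    · rw [h', Nat.sub_self, hA.2.2.2.1] at hy'
      obtain ⟨l, rfl⟩ := Submodule.mem_span_singleton.mp hy'
      rw [hy, h, h', pow_one, mul_smul_comm, mul_one, map_smul]
      exact Submodule.mem_sup_right (Submodule.smul_mem _ _ (Submodule.mem_span_singleton_self _))

/-- A linear form of `Gr_{(z)}(A)` deforms to a family of linear forms of `A`, whose general
members inherit the injectivity and surjectivity of multiplication by powers. -/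
theorem exists_generic_linear_forms (Gr : GrRealization K 𝒜 z) (hA : IsGradedArtinAlg K 𝒜)
    (hz : z ∈ 𝒜 1) {g : Gr.G} (hg : g ∈ Gr.grading 1) :
    ∃ f : K → A, (∀ t, f t ∈ 𝒜 1) ∧
      (∀ n k, (∀ v ∈ Gr.grading n, g ^ k * v = 0 → v = 0) →
        ∀ᶠ t in cofinite, ∀ v ∈ 𝒜 n, f t ^ k * v = 0 → v = 0) ∧
      ∀ n k, (∀ w ∈ Gr.grading (n + k), ∃ v ∈ Gr.grading n, g ^ k * v = w) →
        ∀ᶠ t in cofinite, ∀ w ∈ 𝒜 (n + k), ∃ v ∈ 𝒜 n, f t ^ k * v = w := by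
  classical
  obtain ⟨ψ, hψ⟩ := Gr.exists_linear_extension
  obtain ⟨a, ha, l, hgal⟩ := Gr.exists_eq_of_mem_grading_one hA hz hψ hg
  obtain ⟨ι, _, ord, deg, B, b, hBA, hbG, hBF, hbB, hrep, hrepb⟩ :=
    Gr.exists_homogeneous_adapted_basis hA hz hψ
  have hmul {i j : ℕ} {x y : A} (hx : x ∈ zpowFil K z i) (hy : y ∈ zpowFil K z j) :
      ψ i x * ψ j y = ψ (i + j) (x * y) := by
    rw [hψ _ _ hx, hψ _ _ hy, hψ _ _ (mul_mem_zpowFil hx hy), Gr.map_mul]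
  have haF : a ∈ zpowFil K z 0 := by simp [zpowFil_zero]
  have hzF : z ∈ zpowFil K z 1 := mem_zpowFil.mpr ⟨1, by simp⟩
  have haB (i) : a * B i ∈ zpowFil K z (ord i) := by
    simpa using mul_mem_zpowFil haF (hBF i)
  have hzB (i) : z * B i ∈ zpowFil K z (ord i + 1) := by
    simpa [add_comm] using mul_mem_zpowFil hzF (hBF i)
  have hα (i' i) (h : ord i' < ord i) : Algebra.leftMulMatrix B a i' i = 0 := by
    rw [Algebra.leftMulMatrix_eq_repr_mul]
    exact hrep _ _ (haB i) _ h
  have hβ (i' i) (h : ord i' < ord i + 1) : Algebra.leftMulMatrix B z i' i = 0 := by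
    rw [Algebra.leftMulMatrix_eq_repr_mul]
    exact hrep _ _ (hzB i) _ h
  have hzero : (deformation ord (Algebra.leftMulMatrix B a) (Algebra.leftMulMatrix B z) l).map
      (Polynomial.evalRingHom 0) = Algebra.leftMulMatrix b g := by
    ext i' i
    rw [deformation_map_eval_zero hα hβ]
    simp only [Algebra.leftMulMatrix_eq_repr_mul]
    have hgb : g * b i = ψ (ord i) (a * B i) + l • ψ (ord i + 1) (z * B i) := by
      rw [hgal, hbB, add_mul, smul_mul_assoc, hmul haF (hBF i), hmul hzF (hBF i), zero_add,
        add_comm 1]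
    rw [hgb, map_add, map_smul, Finsupp.add_apply, Finsupp.smul_apply, hrepb _ _ (haB i),
      hrepb _ _ (hzB i), smul_eq_mul]
  have hf (t : K) : a + (l * t⁻¹) • z ∈ 𝒜 1 :=
    Submodule.add_mem _ ha (Submodule.smul_mem _ _ hz)
  have hmat (t : K) : Algebra.leftMulMatrix B a + (l * t⁻¹) • Algebra.leftMulMatrix B z =
      Algebra.leftMulMatrix B (a + (l * t⁻¹) • z) := by
    rw [map_add, map_smul]
  refine ⟨fun t => a + (l * t⁻¹) • z, hf, fun n k h => ?_, fun n k h => ?_⟩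
  · rw [← Gr.isGradedAlg.degreeBlock_injective_iff b hbG hg, ← hzero] at h
    filter_upwards [eventually_degreeBlock_injective hα hβ l deg n (n + k) k h] with t ht
    rwa [hmat, hA.degreeBlock_injective_iff B hBA (hf t)] at ht
  · rw [← Gr.isGradedAlg.degreeBlock_surjective_iff b hbG hg, ← hzero] at h
    filter_upwards [eventually_degreeBlock_surjective hα hβ l deg n (n + k) k h] with t ht
    rwa [hmat, hA.degreeBlock_surjective_iff B hBA (hf t)] at ht

theorem gradedTop_of_gradedTop_grading (Gr : GrRealization K 𝒜 z) (hA : IsGradedArtinAlg K 𝒜)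
    (hz : z ∈ 𝒜 1) {c : ℕ} (hc : GradedTop K Gr.grading c) : GradedTop K 𝒜 c := by
  obtain ⟨ψ, hψ⟩ := Gr.exists_linear_extension
  obtain ⟨ι, _, ord, deg, B, b, hBA, hbG, -⟩ := Gr.exists_homogeneous_adapted_basis hA hz hψ
  have key (d : ℕ) : Gr.grading d ≠ ⊥ ↔ 𝒜 d ≠ ⊥ := by
    rw [ne_bot_iff_exists_deg_eq Gr.isGradedAlg.1.submodule_iSupIndep b hbG,
      ne_bot_iff_exists_deg_eq hA.1.submodule_iSupIndep B hBA]
  exact ⟨(key c).mp hc.1, fun i hi => not_not.mp fun h => (key i).mpr h (hc.2 i hi)⟩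

/-- The associated graded ring with respect to the zero form is `A` itself. -/
noncomputable def ofZero (hA : IsGradedArtinAlg K 𝒜) : GrRealization K 𝒜 0 where
  G := A
  grading := 𝒜
  isGradedAlg := hA
  φ j := if j = 0 then (zpowFil K 0 j).subtype else 0
  ker_eq j x := by
    have h1 (j : ℕ) (y : A) : y ∈ zpowFil K 0 (j + 1) ↔ y = 0 := by
      simp [mem_zpowFil]
    rw [h1]
    rcases j with _ | j
    · simp
    · simpa using (h1 j x).mp x.2
  map_one _ := rfl
  map_mul i j x y hx hy hxy := by
    by_cases hi : i = 0
    · by_cases hj : j = 0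
      · subst hi hj
        simp
      · simp [hi, hj]
    · simp [hi]
  grade_mem j d x hx hxd := by
    split_ifs
    · exact hxd
    · simp
  indep := by
    intro j
    rcases j with _ | j
    · have : (⨆ i, ⨆ (_ : i ≠ 0), LinearMap.range
          (if i = 0 then (zpowFil K (0 : A) i).subtype else 0)) = ⊥ := by
        simp only [iSup_eq_bot]
        intro i hi
        simp [hi]
      rw [this]
      exact disjoint_bot_right
    · simp
  spans := by
    refine eq_top_iff.mpr fun x _ => Submodule.mem_iSup_of_mem 0 ?_
    exact ⟨⟨x, by simp [zpowFil_zero]⟩, rfl⟩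

theorem hasWLP_of_grading [Infinite K] (Gr : GrRealization K 𝒜 z) (hA : IsGradedArtinAlg K 𝒜)
    (hz : z ∈ 𝒜 1) (h : AlgHasWLP K Gr.grading) : AlgHasWLP K 𝒜 := by
  obtain ⟨c, hc, g, hg, hL⟩ := h
  obtain ⟨f, hf, hinj, hsurj⟩ := Gr.exists_generic_linear_forms hA hz hg
  have hev : ∀ᶠ t in cofinite, ∀ i ∈ Finset.range c,
      ((∀ v ∈ 𝒜 i, f t * v = 0 → v = 0) ∨ (∀ w ∈ 𝒜 (i + 1), ∃ v ∈ 𝒜 i, f t * v = w)) := by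
    rw [eventually_all_finset]
    intro i hi
    rcases hL i (Finset.mem_range.mp hi) with h | h
    · filter_upwards [hinj i 1 (by simpa only [pow_one] using h)] with t ht
      exact Or.inl (by simpa only [pow_one] using ht)
    · filter_upwards [hsurj i 1 (by simpa only [pow_one] using h)] with t ht
      exact Or.inr (by simpa only [pow_one] using ht)
  obtain ⟨t, ht⟩ := hev.exists
  exact ⟨c, Gr.gradedTop_of_gradedTop_grading hA hz hc, f t, hf t,
    fun i hi => ht i (Finset.mem_range.mpr hi)⟩

theorem hasSLP_of_grading [Infinite K] (Gr : GrRealization K 𝒜 z) (hA : IsGradedArtinAlg K 𝒜)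
    (hz : z ∈ 𝒜 1) (h : AlgHasSLP K Gr.grading) : AlgHasSLP K 𝒜 := by
  obtain ⟨c, hc, g, hg, hL⟩ := h
  obtain ⟨f, hf, hinj, hsurj⟩ := Gr.exists_generic_linear_forms hA hz hg
  have hev : ∀ᶠ t in cofinite, ∀ i ∈ Finset.range (c + 1), 2 * i ≤ c →
      (∀ v ∈ 𝒜 i, f t ^ (c - 2 * i) * v = 0 → v = 0) ∧
      (∀ w ∈ 𝒜 (c - i), ∃ v ∈ 𝒜 i, f t ^ (c - 2 * i) * v = w) := by
    rw [eventually_all_finset]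
    intro i _
    by_cases hi : 2 * i ≤ c
    · have hci : c - i = i + (c - 2 * i) := by omega
      obtain ⟨h1, h2⟩ := hL i hi
      rw [hci] at h2 ⊢
      filter_upwards [hinj i _ h1, hsurj i _ h2] with t ht1 ht2 _
      exact ⟨ht1, ht2⟩
    · exact Eventually.of_forall fun t h => absurd h hi
  obtain ⟨t, ht⟩ := hev.exists
  exact ⟨c, Gr.gradedTop_of_gradedTop_grading hA hz hc, f t, hf t,
    fun i hi => ht i (Finset.mem_range.mpr (by omega)) hi⟩

end GrRealization

end Transfer

/-- Theorem 4.5. Let `K` be a field of characteristic zero and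
`A` a graded Artinian `K`-algebra.  Then `A` has the WLP (resp. SLP) if and only
if there is a linear form `z ∈ A₁` such that the associated graded ring
`Gr_{(z)}(A)` has the WLP (resp. SLP). -/
theorem statement_7 {K A : Type} [Field K] [CharZero K] [CommRing A] [Algebra K A]
    (𝒜 : ℕ → Submodule K A) (hA : IsGradedArtinAlg K 𝒜) :
    (AlgHasWLP K 𝒜 ↔
      ∃ z ∈ 𝒜 1, ∃ Gr : GrRealization K 𝒜 z, AlgHasWLP K Gr.grading) ∧
    (AlgHasSLP K 𝒜 ↔
      ∃ z ∈ 𝒜 1, ∃ Gr : GrRealization K 𝒜 z, AlgHasSLP K Gr.grading) := by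
  have : Infinite K := CharZero.infinite K
  refine ⟨⟨fun h => ⟨0, Submodule.zero_mem _, GrRealization.ofZero hA, h⟩, ?_⟩,
    ⟨fun h => ⟨0, Submodule.zero_mem _, GrRealization.ofZero hA, h⟩, ?_⟩⟩
  · rintro ⟨z, hz, Gr, h⟩
    exact Gr.hasWLP_of_grading hA hz h
  · rintro ⟨z, hz, Gr, h⟩
    exact Gr.hasSLP_of_grading hA hz h
end
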